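/- Let G = (A ∪ B, E) be a 6-edge-connected bipartite finite simple graph such that the degree of each vertex in A is divisible by 5. Then there is an orientation of the edges of G making it a directed graph G⃗ that admits a fractional factorization 𝔉 = (M, F, H) for A and an 𝔉-canonical decomposition. -/

import Mathlib

open SimpleGraph

/-- A graph `G` is `k`-edge-connected if it remains connected after the deletion of
any fewer than `k` edges. -/
def IsKEdgeConnected {V : Type} (G : SimpleGraph V) (k : ℕ) : Prop :=
  ∀ S : Finset (Sym2 V), S.card < k → (G.deleteEdges ↑S).Connected

variable {V : Type}

/-- The indegree of `v` with respect to a set `S` of directed edges. -/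
noncomputable def dInDeg (S : Set (V × V)) (v : V) : ℕ := {u : V | (u, v) ∈ S}.ncard

/-- The outdegree of `v` with respect to a set `S` of directed edges. -/
noncomputable def dOutDeg (S : Set (V × V)) (v : V) : ℕ := {u : V | (v, u) ∈ S}.ncard

/-- The (total) degree of `v` in the directed graph with adjacency relation `D`. -/
noncomputable def dDeg (D : V → V → Prop) (v : V) : ℕ :=
  {u : V | D u v}.ncard + {u : V | D v u}.ncard

/-- `D` is an orientation of the simple graph `G`: each edge of `G` receives exactly
one direction. -/
def IsOrientationOf (D : V → V → Prop) (G : SimpleGraph V) : Prop :=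
  (∀ u v, G.Adj u v ↔ (D u v ∨ D v u)) ∧ (∀ u v, ¬ (D u v ∧ D v u))

/-- `(M, F, H)` is a fractional factorization for `A` of the bipartite directed graph
with adjacency relation `D` and vertex classes `A` and `Aᶜ`:  `M`, `F`, `H` partition
the directed edge set; every edge of `M` is directed from `Aᶜ` to `A`; for `v ∈ A`
the indegree and outdegree of `v` in `F` and in `H` and the indegree of `v` in `M`
all equal `d(v)/5`; and every `v ∉ A` has equal indegree and outdegree in `F`, and
equal indegree and outdegree in `H`. -/
def IsFracFactorization (D : V → V → Prop) (A : Set V)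
    (M F H : Set (V × V)) : Prop :=
  (M ∪ F ∪ H = {e : V × V | D e.1 e.2}) ∧
  Disjoint M F ∧ Disjoint M H ∧ Disjoint F H ∧
  (∀ e ∈ M, e.1 ∉ A ∧ e.2 ∈ A) ∧
  (∀ v ∈ A, dInDeg F v = dDeg D v / 5 ∧ dOutDeg F v = dDeg D v / 5 ∧
            dInDeg H v = dDeg D v / 5 ∧ dOutDeg H v = dDeg D v / 5 ∧
            dInDeg M v = dDeg D v / 5) ∧
  (∀ v, v ∉ A → (dInDeg F v = dOutDeg F v ∧ dInDeg H v = dOutDeg H v))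

/-- The list of the five consecutive directed edges of the trail `a b c d e f`. -/
def tupleEdges5 : V × V × V × V × V × V → List (V × V)
  | (a, b, c, d, e, f) => [(a, b), (b, c), (c, d), (d, e), (e, f)]

/-- The trail `a b c d e f` is an `(M,F,H)`-canonical element (an `𝔉`-canonical path
or an `𝔉`-canonical trail): `ab ∈ M`, `bc, cd ∈ F`, `de, ef ∈ H` and its initial
segment `a b c d e` is an `𝔉`-basic path, i.e. `a, b, c, d, e` are distinct. -/
def IsCanonicalElt (M F H : Set (V × V)) : V × V × V × V × V × V → Prop
  | (a, b, c, d, e, f) =>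
      (a, b) ∈ M ∧ (b, c) ∈ F ∧ (c, d) ∈ F ∧ (d, e) ∈ H ∧ (e, f) ∈ H ∧
      ([a, b, c, d, e] : List V).Nodup

/-- The directed graph with adjacency relation `D` admits an `(M,F,H)`-canonical
decomposition: a family of edge-disjoint `(M,F,H)`-canonical trails of length five
(each with its five edges distinct) covering every directed edge exactly once. -/
def HasCanonicalDecomposition (D : V → V → Prop) (M F H : Set (V × V)) : Prop :=
  ∃ (n : ℕ) (t : Fin n → V × V × V × V × V × V),
    (∀ i, IsCanonicalElt M F H (t i)) ∧
    (∀ i, (tupleEdges5 (t i)).Nodup) ∧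
    (∀ e : V × V, D e.1 e.2 ↔ ∃ i, e ∈ tupleEdges5 (t i)) ∧
    (∀ i j (e : V × V), e ∈ tupleEdges5 (t i) → e ∈ tupleEdges5 (t j) → i = j)

open Finset in
open Classical in
theorem cd_exists_half {E L R : Type} (s : Finset E) (l : E → L) (r : E → R) :
    ∃ t ⊆ s, (∀ a, #{e ∈ s | l e = a} / 2 ≤ #{e ∈ t | l e = a}) ∧
      ∀ b, #{e ∈ s | r e = b} / 2 ≤ #{e ∈ s \ t | r e = b} := by
  let T : (Σ a : L, Fin (#{e ∈ s | l e = a} / 2)) ⊕ (Σ b : R, Fin (#{e ∈ s | r e = b} / 2)) →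
      Finset E := Sum.elim (fun i => {e ∈ s | l e = i.1}) (fun i => {e ∈ s | r e = i.1})
  have key : ∀ Z, #Z ≤ #(Z.biUnion T) := by
    intro Z
    have h1 : #Z.toLeft + #Z.toRight = #Z := Finset.card_toLeft_add_card_toRight
    have h2 : #Z.toLeft ≤ ∑ a ∈ Z.toLeft.image Sigma.fst, #{e ∈ s | l e = a} / 2 := by
      calc #Z.toLeft ≤ #((Z.toLeft.image Sigma.fst).sigma
            (fun a => (univ : Finset (Fin (#{e ∈ s | l e = a} / 2))))) := by
            apply card_le_card
            intro i hi
            simp only [mem_sigma, mem_univ, and_true]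
            exact mem_image_of_mem _ hi
        _ = _ := by simp [card_sigma]
    have h3 : #Z.toRight ≤ ∑ b ∈ Z.toRight.image Sigma.fst, #{e ∈ s | r e = b} / 2 := by
      calc #Z.toRight ≤ #((Z.toRight.image Sigma.fst).sigma
            (fun a => (univ : Finset (Fin (#{e ∈ s | r e = a} / 2))))) := by
            apply card_le_card
            intro i hi
            simp only [mem_sigma, mem_univ, and_true]
            exact mem_image_of_mem _ hi
        _ = _ := by simp [card_sigma]
    have h4 : ∑ a ∈ Z.toLeft.image Sigma.fst, #{e ∈ s | l e = a} ≤ #(Z.biUnion T) := by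
      rw [← card_biUnion]
      · apply card_le_card
        intro e he
        simp only [mem_biUnion, mem_image, mem_toLeft, mem_filter] at he ⊢
        obtain ⟨a, ⟨i, hi, rfl⟩, he⟩ := he
        exact ⟨_, hi, by simpa [T] using he⟩
      · intro a _ b _ hab
        refine disjoint_left.2 ?_
        intro e h1 h2
        simp only [mem_filter] at h1 h2
        exact hab (h1.2.symm.trans h2.2)
    have h5 : ∑ a ∈ Z.toRight.image Sigma.fst, #{e ∈ s | r e = a} ≤ #(Z.biUnion T) := by
      rw [← card_biUnion]
      · apply card_le_card
        intro e he
        simp only [mem_biUnion, mem_image, mem_toRight, mem_filter] at he ⊢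
        obtain ⟨a, ⟨i, hi, rfl⟩, he⟩ := he
        exact ⟨_, hi, by simpa [T] using he⟩
      · intro a _ b _ hab
        refine disjoint_left.2 ?_
        intro e h1 h2
        simp only [mem_filter] at h1 h2
        exact hab (h1.2.symm.trans h2.2)
    have h6 : 2 * ∑ a ∈ Z.toLeft.image Sigma.fst, #{e ∈ s | l e = a} / 2 ≤
        ∑ a ∈ Z.toLeft.image Sigma.fst, #{e ∈ s | l e = a} := by
      rw [mul_sum]; exact sum_le_sum fun a _ => by omega
    have h7 : 2 * ∑ a ∈ Z.toRight.image Sigma.fst, #{e ∈ s | r e = a} / 2 ≤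
        ∑ a ∈ Z.toRight.image Sigma.fst, #{e ∈ s | r e = a} := by
      rw [mul_sum]; exact sum_le_sum fun a _ => by omega
    omega
  obtain ⟨f, finj, hf⟩ := (Finset.all_card_le_biUnion_card_iff_exists_injective T).1 key
  refine ⟨{e ∈ s | ∃ i, f (Sum.inl i) = e}, filter_subset _ _, ?_, ?_⟩
  · intro a
    have : #(univ : Finset (Fin (#{e ∈ s | l e = a} / 2))) ≤
        #{e ∈ {e ∈ s | ∃ i, f (Sum.inl i) = e} | l e = a} := by
      apply card_le_card_of_injOn (fun j => f (Sum.inl ⟨a, j⟩))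
      · intro j _
        have := hf (Sum.inl ⟨a, j⟩)
        simp only [T, Sum.elim_inl, mem_filter] at this
        simp only [coe_filter, mem_filter, Set.mem_ofPred_eq]
        exact ⟨⟨this.1, _, rfl⟩, this.2⟩
      · intro j _ j' _ h
        simpa using finj h
    simpa using this
  · intro a
    have : #(univ : Finset (Fin (#{e ∈ s | r e = a} / 2))) ≤
        #{e ∈ s \ {e ∈ s | ∃ i, f (Sum.inl i) = e} | r e = a} := by
      apply card_le_card_of_injOn (fun j => f (Sum.inr ⟨a, j⟩))
      · intro j _
        have := hf (Sum.inr ⟨a, j⟩)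
        simp only [T, Sum.elim_inr, mem_filter] at this
        simp only [coe_filter, mem_filter, Set.mem_ofPred_eq, mem_sdiff, not_and, not_exists]
        refine ⟨⟨this.1, fun _ i hi => ?_⟩, this.2⟩
        have := finj hi
        simp at this
      · intro j _ j' _ h
        simpa using finj h
    simpa using this

open Finset in
open Classical in
theorem cd_halve {E L R : Type} [Fintype L] [Fintype R] (s : Finset E) (l : E → L) (r : E → R)
    (hl : ∀ a, Even #{e ∈ s | l e = a}) (hr : ∀ a, Even #{e ∈ s | r e = a}) :
    ∃ t ⊆ s, (∀ a, 2 * #{e ∈ t | l e = a} = #{e ∈ s | l e = a}) ∧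
      ∀ b, 2 * #{e ∈ t | r e = b} = #{e ∈ s | r e = b} := by
  obtain ⟨t, hts, h1, h2⟩ := cd_exists_half s l r
  have e1 : ∀ u : Finset E, #u = ∑ a, #{e ∈ u | l e = a} := fun u =>
    card_eq_sum_card_fiberwise (fun _ _ => by simp)
  have e2 : ∀ u : Finset E, #u = ∑ a, #{e ∈ u | r e = a} := fun u =>
    card_eq_sum_card_fiberwise (fun _ _ => by simp)
  have h1' : ∀ a ∈ univ, #{e ∈ s | l e = a} ≤ 2 * #{e ∈ t | l e = a} := fun a _ => by
    have := h1 a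
    obtain ⟨m, hm⟩ := hl a
    omega
  have h2' : ∀ a ∈ univ, #{e ∈ s | r e = a} ≤ 2 * #{e ∈ s \ t | r e = a} := fun a _ => by
    have := h2 a
    obtain ⟨m, hm⟩ := hr a
    omega
  have s1 := sum_le_sum h1'
  have s2 := sum_le_sum h2'
  rw [← mul_sum, ← e1, ← e1] at s1
  rw [← mul_sum, ← e2, ← e2] at s2
  have s3 : #(s \ t) + #t = #s := card_sdiff_add_card_eq_card hts
  have q1 := (sum_eq_sum_iff_of_le h1').1 (by rw [← mul_sum, ← e1, ← e1]; omega)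
  have q2 := (sum_eq_sum_iff_of_le h2').1 (by rw [← mul_sum, ← e2, ← e2]; omega)
  refine ⟨t, hts, fun a => (q1 a (mem_univ _)).symm, fun b => ?_⟩
  have := q2 b (mem_univ _)
  have s4 : #{e ∈ s \ t | r e = b} + #{e ∈ t | r e = b} = #{e ∈ s | r e = b} := by
    rw [← card_union_of_disjoint, ← filter_union, sdiff_union_of_subset hts]
    exact disjoint_filter_filter sdiff_disjoint
  omega

open Finset in
open Classical in
/-- matching two finite sets fiberwise -/
theorem cd_fiber_equiv {E X : Type} (s t : Finset E) (f g : E → X)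
    (h : ∀ a, #{e ∈ s | f e = a} = #{e ∈ t | g e = a}) :
    ∃ φ : s ≃ t, ∀ e : s, g (φ e) = f e := by
  have : ∀ a, Nonempty ({e : s // f e = a} ≃ {e : t // g e = a}) := by
    intro a
    rw [← Fintype.card_eq, Fintype.card_subtype, Fintype.card_subtype]
    have h1 : ∀ (u : Finset E) (k : E → X), #{e : u | k e = a} = #{e ∈ u | k e = a} := by
      intro u k
      rw [← card_map (Function.Embedding.subtype _)]
      congr 1
      ext e
      simp only [mem_map, mem_filter, mem_univ, true_and, Function.Embedding.coe_subtype,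
        Subtype.exists]
      constructor
      · rintro ⟨e', h, h', rfl⟩; exact ⟨h, h'⟩
      · rintro ⟨h, h'⟩; exact ⟨e, h, h', rfl⟩
    rw [h1, h1, h]
  let φ : s ≃ t := Equiv.ofFiberEquiv (f := fun e : s => f e) (g := fun e : t => g e)
    (fun a => (this a).some)
  refine ⟨φ, fun e => ?_⟩
  exact Equiv.ofFiberEquiv_map (f := fun e : s => f e) (g := fun e : t => g e) _ e

open Finset in
open Classical in
/-- Rado-type lemma for vectors -/
theorem cd_rado {E I K W : Type} [Field K] [AddCommGroup W] [Module K W] [FiniteDimensional K W]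
    [Fintype E] [Fintype I] (p : E → I) (vec : E → W) (c : I → ℕ)
    (h : ∀ Y : Finset I, Module.finrank K (Submodule.span K (Set.range vec)) ≤
      Module.finrank K (Submodule.span K (vec '' {e | p e ∈ Y})) + ∑ v ∈ Yᶜ, c v) :
    ∃ T : Finset E, (∀ v, #{e ∈ T | p e = v} ≤ c v) ∧
      Submodule.span K (vec '' T) = Submodule.span K (Set.range vec) := by
  let S : Finset E → Finset I → Submodule K W := fun T Y =>
    Submodule.span K (vec '' {e | e ∈ T ∧ p e ∈ Y})
  let r : Finset E → Finset I → ℕ := fun T Y => Module.finrank K (S T Y)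
  set w := Module.finrank K (Submodule.span K (Set.range vec)) with hw
  have hne : ({T : Finset E | ∀ Y : Finset I, w ≤ r T Y + ∑ v ∈ Yᶜ, c v} : Finset _).Nonempty := by
    refine ⟨univ, ?_⟩
    simp only [mem_filter, mem_univ, true_and]
    intro Y
    refine (h Y).trans (Nat.add_le_add_right (Submodule.finrank_mono
      (Submodule.span_mono (Set.image_mono (by intro e he; exact ⟨mem_univ _, he⟩)))) _)
  obtain ⟨T, hT, hmin⟩ := exists_min_image _ (fun T : Finset E => #T) hne
  simp only [mem_filter, mem_univ, true_and] at hT hmin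
  have hle : S T univ ≤ Submodule.span K (Set.range vec) :=
    Submodule.span_mono (by rintro _ ⟨e, _, rfl⟩; exact ⟨e, rfl⟩)
  refine ⟨T, ?_, ?_⟩
  swap
  · have h1 : w ≤ r T univ := by simpa using hT univ
    have := Submodule.eq_of_le_of_finrank_le hle h1
    simpa [S] using this
  intro v
  by_contra! hv
  have hY : ∀ e ∈ T, ∃ Y, vec e ∉ S (T.erase e) Y ∧ p e ∈ Y ∧ r T Y + ∑ v ∈ Yᶜ, c v ≤ w := by
    intro e he
    have h1 : ¬ ∀ Y : Finset I, w ≤ r (T.erase e) Y + ∑ v ∈ Yᶜ, c v := by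
      intro hh
      have := hmin _ hh
      have := card_erase_lt_of_mem he
      omega
    push Not at h1
    obtain ⟨Y, hY⟩ := h1
    have h2 := hT Y
    have h3 : S T Y ≠ S (T.erase e) Y := by
      intro hh
      have : r T Y = r (T.erase e) Y := congrArg (fun U : Submodule K W => Module.finrank K U) hh
      omega
    have h4 : S T Y ≤ S (T.erase e) Y ⊔ Submodule.span K {vec e} := by
      apply Submodule.span_le.2
      rintro _ ⟨e', ⟨h, h'⟩, rfl⟩
      by_cases hee : e' = e
      · subst hee
        exact Submodule.mem_sup_right (Submodule.mem_span_singleton_self _)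
      · exact Submodule.mem_sup_left (Submodule.subset_span ⟨e', ⟨mem_erase.2 ⟨hee, h⟩, h'⟩, rfl⟩)
    have h5 : S (T.erase e) Y ≤ S T Y :=
      Submodule.span_mono (Set.image_mono fun e' h => ⟨mem_of_mem_erase h.1, h.2⟩)
    refine ⟨Y, ?_, ?_, ?_⟩
    · intro hh
      apply h3
      apply le_antisymm _ h5
      refine h4.trans (sup_le le_rfl ?_)
      rw [Submodule.span_singleton_le_iff_mem]; exact hh
    · by_contra hh
      apply h3
      apply le_antisymm _ h5
      apply Submodule.span_mono (Set.image_mono _)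
      rintro e' ⟨h, h'⟩
      exact ⟨mem_erase.2 ⟨by rintro rfl; exact hh h', h⟩, h'⟩
    · have h6 : r T Y ≤ r (T.erase e) Y + 1 := by
        calc r T Y ≤ Module.finrank K ↥(S (T.erase e) Y ⊔ Submodule.span K {vec e}) :=
              Submodule.finrank_mono h4
          _ ≤ r (T.erase e) Y + Module.finrank K (Submodule.span K {vec e}) :=
              Submodule.finrank_add_le_finrank_add_finrank _ _
          _ ≤ _ := by
              have := finrank_span_le_card (R := K) ({vec e} : Set W)
              simp only [Set.toFinset_singleton, card_singleton] at this
              omega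
      omega
  have hmono : ∀ T' Y Y', Y ⊆ Y' → S T' Y ≤ S T' Y' := fun T' Y Y' h =>
    Submodule.span_mono (Set.image_mono fun e' h' => ⟨h'.1, h h'.2⟩)
  have hsub : ∀ Y Y', r T (Y ∩ Y') + r T (Y ∪ Y') ≤ r T Y + r T Y' := by
    intro Y Y'
    have h1 := Submodule.finrank_sup_add_finrank_inf_eq (S T Y) (S T Y')
    have h2 : S T (Y ∩ Y') ≤ S T Y ⊓ S T Y' :=
      le_inf (hmono _ _ _ inter_subset_left) (hmono _ _ _ inter_subset_right)
    have h3 : S T (Y ∪ Y') ≤ S T Y ⊔ S T Y' := by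
      apply Submodule.span_le.2
      rintro _ ⟨e', ⟨h, h'⟩, rfl⟩
      rcases mem_union.1 h' with h' | h'
      · exact Submodule.mem_sup_left (Submodule.subset_span ⟨e', ⟨h, h'⟩, rfl⟩)
      · exact Submodule.mem_sup_right (Submodule.subset_span ⟨e', ⟨h, h'⟩, rfl⟩)
    have h4 := Submodule.finrank_mono h2
    have h5 := Submodule.finrank_mono h3
    simp only [r]
    omega
  have hall : ∀ s : Finset E, s ⊆ ({e ∈ T | p e = v} : Finset E) →
      ∃ Y, v ∈ Y ∧ r T Y + ∑ v ∈ Yᶜ, c v ≤ w ∧ ∀ e ∈ s, vec e ∉ S (T.erase e) Y := by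
    intro s
    induction s using Finset.induction_on with
    | empty =>
      intro _
      refine ⟨univ, mem_univ _, ?_, by simp⟩
      simpa using Submodule.finrank_mono hle
    | insert e s hes ih =>
      intro hs
      obtain ⟨Y, hvY, hYt, hYs⟩ := ih ((subset_insert _ _).trans hs)
      have he := hs (mem_insert_self _ _)
      simp only [mem_filter] at he
      obtain ⟨Y', h1, h2, h3⟩ := hY e he.1
      refine ⟨Y ∩ Y', mem_inter.2 ⟨hvY, he.2 ▸ h2⟩, ?_, ?_⟩
      · have a1 := hsub Y Y'
        have a2 := hT (Y ∪ Y')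
        have a3 : ∑ v ∈ (Y ∩ Y')ᶜ, c v + ∑ v ∈ (Y ∪ Y')ᶜ, c v =
            ∑ v ∈ Yᶜ, c v + ∑ v ∈ Y'ᶜ, c v := by
          rw [compl_inter, compl_union, sum_union_inter]
        omega
      · intro e' he'
        rcases mem_insert.1 he' with rfl | he'
        · exact fun hh => h1 (hmono _ _ _ inter_subset_right hh)
        · exact fun hh => hYs e' he' (hmono _ _ _ inter_subset_left hh)
  obtain ⟨Y, hvY, hYt, hYs⟩ := hall _ subset_rfl
  have hgrow : ∀ s : Finset E, s ⊆ ({e ∈ T | p e = v} : Finset E) →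
      r T (Y.erase v) + #s ≤
        Module.finrank K (Submodule.span K (vec '' {e | e ∈ s ∨ e ∈ T ∧ p e ∈ Y.erase v})) := by
    intro s
    induction s using Finset.induction_on with
    | empty =>
      intro _
      rw [card_empty, add_zero]
      exact Submodule.finrank_mono (Submodule.span_mono (Set.image_mono fun e he => Or.inr he))
    | insert e s hes ih =>
      intro hs
      have ih := ih ((subset_insert _ _).trans hs)
      have he := hs (mem_insert_self _ _)
      simp only [mem_filter] at he
      rw [card_insert_of_notMem hes]
      have : Submodule.span K (vec '' {e | e ∈ s ∨ e ∈ T ∧ p e ∈ Y.erase v}) <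
          Submodule.span K (vec '' {e' | e' ∈ insert e s ∨ e' ∈ T ∧ p e' ∈ Y.erase v}) := by
        apply lt_of_le_of_ne
        · apply Submodule.span_mono (Set.image_mono _)
          rintro e' (h | h)
          · exact Or.inl (mem_insert_of_mem h)
          · exact Or.inr h
        · intro hh
          apply hYs e (by simpa using he)
          have h1 : vec e ∈ Submodule.span K (vec '' {e' | e' ∈ insert e s ∨ e' ∈ T ∧ p e' ∈ Y.erase v}) :=
            Submodule.subset_span ⟨e, Or.inl (mem_insert_self _ _), rfl⟩
          rw [← hh] at h1
          refine Submodule.span_mono (Set.image_mono ?_) h1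
          rintro e' (h | h)
          · have := hs (mem_insert_of_mem h)
            simp only [mem_filter] at this
            exact ⟨mem_erase.2 ⟨by rintro rfl; exact hes h, this.1⟩, this.2 ▸ hvY⟩
          · refine ⟨mem_erase.2 ⟨?_, h.1⟩, mem_of_mem_erase h.2⟩
            rintro rfl
            exact (mem_erase.1 h.2).1 he.2
      have := Submodule.finrank_lt_finrank_of_lt this
      omega
  have h1 := hgrow _ subset_rfl
  have h2 : Module.finrank K (Submodule.span K (vec '' {e | e ∈ ({e ∈ T | p e = v} : Finset E) ∨
      e ∈ T ∧ p e ∈ Y.erase v})) ≤ r T Y := by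
    apply Submodule.finrank_mono
    apply Submodule.span_mono (Set.image_mono _)
    rintro e' (h | h)
    · simp only [mem_filter] at h
      exact ⟨h.1, h.2 ▸ hvY⟩
    · exact ⟨h.1, mem_of_mem_erase h.2⟩
  have h3 := hT (Y.erase v)
  have h4 : ∑ u ∈ (Y.erase v)ᶜ, c u = c v + ∑ u ∈ Yᶜ, c u := by
    rw [compl_erase, sum_insert (by simpa using hvY)]
  omega

open Finset in
open Classical in
theorem cd_pairs {ι K γ : Type} (k : ℕ) : ∀ (N : Finset ι) (c : ι → γ),
    #(N.image c) ≤ k + 1 → 2 * k + 1 ≤ #N →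
    ∃ p q : Fin k → ι, Function.Injective p ∧ Function.Injective q ∧ (∀ i j, p i ≠ q j) ∧
      (∀ i, p i ∈ N ∧ q i ∈ N) ∧
      ∀ g : ι → K, (∀ u ∈ N, ∀ w ∈ N, c u = c w → g u = g w) → (∀ i, g (p i) = g (q i)) →
        ∀ u ∈ N, ∀ w ∈ N, g u = g w := by
  induction k with
  | zero =>
    intro N c h1 _
    refine ⟨Fin.elim0, Fin.elim0, fun i => i.elim0, fun i => i.elim0, fun i => i.elim0,
      fun i => i.elim0, fun g hg _ u hu w hw => hg u hu w hw ?_⟩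
    exact card_le_one.1 h1 _ (mem_image_of_mem _ hu) _ (mem_image_of_mem _ hw)
  | succ k ih =>
    intro N c h1 h2
    obtain ⟨x, hx, z, hz, hxz, hc⟩ := exists_ne_map_eq_of_card_lt_of_maps_to
      (s := N) (t := N.image c) (f := c) (by omega) (fun a ha => mem_image_of_mem c ha)
    have hy : ∃ y ∈ N, y ≠ x ∧ y ≠ z ∧ (c y ≠ c x ∨ ∀ w ∈ N, c w = c x) := by
      by_cases hh : ∀ w ∈ N, c w = c x
      · have : 0 < #((N.erase x).erase z) := by
          rw [card_erase_of_mem (mem_erase.2 ⟨hxz.symm, hz⟩), card_erase_of_mem hx]; omega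
        obtain ⟨y, hy⟩ := card_pos.1 this
        simp only [mem_erase] at hy
        exact ⟨y, hy.2.2, hy.2.1, hy.1, Or.inr hh⟩
      · push Not at hh
        obtain ⟨y, hy, hyx⟩ := hh
        refine ⟨y, hy, ?_, ?_, Or.inl hyx⟩
        · rintro rfl; exact hyx rfl
        · rintro rfl; exact hyx hc.symm
    obtain ⟨y, hy, hyx, hyz, hyc⟩ := hy
    let N' := (N.erase x).erase y
    have hN' : #N' = #N - 2 := by
      simp only [N']
      rw [card_erase_of_mem (mem_erase.2 ⟨hyx, hy⟩), card_erase_of_mem hx]; omega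
    have hmem : ∀ u, u ∈ N' ↔ u ≠ y ∧ u ≠ x ∧ u ∈ N := by intro u; simp [N']
    let c' : ι → γ := fun u => if c u = c y then c x else c u
    have himg : #(N'.image c') ≤ k + 1 := by
      rcases hyc with hyc | hyc
      · have : N'.image c' ⊆ (N.image c).erase (c y) := by
          intro a ha
          obtain ⟨u, hu, rfl⟩ := mem_image.1 ha
          rw [hmem] at hu
          simp only [c']
          split_ifs with h
          · exact mem_erase.2 ⟨hyc.symm, mem_image_of_mem _ hx⟩
          · exact mem_erase.2 ⟨h, mem_image_of_mem _ hu.2.2⟩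
        have := card_le_card this
        rw [card_erase_of_mem (mem_image_of_mem _ hy)] at this
        omega
      · have : N'.image c' ⊆ {c x} := by
          intro a ha
          obtain ⟨u, hu, rfl⟩ := mem_image.1 ha
          rw [hmem] at hu
          simp [c', hyc u hu.2.2]
        have := card_le_card this
        rw [card_singleton] at this
        omega
    obtain ⟨p, q, pinj, qinj, hpq, hN, hg⟩ := ih N' c' himg (by omega)
    simp only [hmem] at hN hg
    refine ⟨Fin.cons x p, Fin.cons y q, ?_, ?_, ?_, ?_, ?_⟩
    · rw [Fin.cons_injective_iff]
      exact ⟨by rintro ⟨i, hi⟩; exact (hN i).1.2.1 hi, pinj⟩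
    · rw [Fin.cons_injective_iff]
      exact ⟨by rintro ⟨i, hi⟩; exact (hN i).2.1 hi, qinj⟩
    · intro i j
      refine Fin.cases ?_ (fun i => ?_) i <;> refine Fin.cases ?_ (fun j => ?_) j
      · simpa using hyx.symm
      · simpa using (hN j).2.2.1.symm
      · simpa using (hN i).1.1
      · simpa using hpq i j
    · intro i
      refine Fin.cases ?_ (fun i => ?_) i
      · exact ⟨hx, hy⟩
      · exact ⟨(hN i).1.2.2, (hN i).2.2.2⟩
    · intro g h3 h4
      have hxy : g x = g y := by simpa using h4 0
      have hcx : ∀ u ∈ N, c u = c y → g u = g x := fun u hu h => (h3 u hu y hy h).trans hxy.symm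
      have h5 : ∀ u, (u ≠ y ∧ u ≠ x ∧ u ∈ N) → ∀ w, (w ≠ y ∧ w ≠ x ∧ w ∈ N) → g u = g w := by
        apply hg g
        · intro u hu w hw huw
          simp only [c'] at huw
          split_ifs at huw with a b b
          · rw [hcx u hu.2.2 a, hcx w hw.2.2 b]
          · rw [hcx u hu.2.2 a]; exact h3 x hx w hw.2.2 huw
          · rw [hcx w hw.2.2 b]; exact h3 u hu.2.2 x hx huw
          · exact h3 u hu.2.2 w hw.2.2 huw
        · intro i
          simpa using h4 i.succ
      have h6 : ∀ u ∈ N, g u = g z := by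
        intro u hu
        have hxz' : g x = g z := h3 x hx z hz hc
        by_cases a : u = y
        · rw [a, ← hxy, hxz']
        by_cases b : u = x
        · rw [b, hxz']
        exact h5 u ⟨a, b, hu⟩ z ⟨hyz.symm, hxz.symm, hz⟩
      intro u hu w hw
      rw [h6 u hu, h6 w hw]

/-- The edges of a bipartite graph, as pairs with first end in `A`. -/
abbrev CDE {V : Type} (G : SimpleGraph V) (A : Set V) : Type :=
  {e : V × V // e.1 ∈ A ∧ G.Adj e.1 e.2}

open Finset in
open Classical in
theorem cd_cut {V : Type} [Fintype V] (G : SimpleGraph V) (A : Set V)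
    (hbip : ∀ u v, G.Adj u v → (u ∈ A ↔ v ∉ A))
    (hconn : IsKEdgeConnected G 6) (C : Set V) (a b : V) (ha : a ∈ C) (hb : b ∉ C) :
    6 ≤ #{e : CDE G A | ¬ (e.1.1 ∈ C ↔ e.1.2 ∈ C)} := by
  by_contra hlt
  rw [not_le] at hlt
  let S : Finset (Sym2 V) :=
    ({e : CDE G A | ¬ (e.1.1 ∈ C ↔ e.1.2 ∈ C)} : Finset (CDE G A)).image
      (fun e => s(e.1.1, e.1.2))
  have hS : S.card < 6 := card_image_le.trans_lt hlt
  obtain ⟨w⟩ := (hconn S hS).preconnected a b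
  obtain ⟨d, hd, h1, h2⟩ := w.exists_boundary_dart C ha hb
  have hadj := d.adj
  rw [SimpleGraph.deleteEdges_adj] at hadj
  apply hadj.2
  simp only [S, coe_image, Set.mem_image]
  by_cases hA : d.fst ∈ A
  · exact ⟨⟨(d.fst, d.snd), hA, hadj.1⟩, by simp [h1, h2], rfl⟩
  · have : d.snd ∈ A := by
      by_contra h
      exact hA ((hbip _ _ hadj.1).2 h)
    exact ⟨⟨(d.snd, d.fst), this, hadj.1.symm⟩, by simp [h1, h2], Sym2.eq_swap⟩

/-- The vector of an edge. -/
noncomputable def cdVec {V : Type} (G : SimpleGraph V) (A : Set V) (e : CDE G A) : V → ZMod 2 :=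
  open Classical in Pi.single e.1.1 1 + Pi.single e.1.2 1

open Finset in
open Classical in
theorem cd_star {V : Type} [Fintype V] (G : SimpleGraph V) (A : Set V)
    (hbip : ∀ u v, G.Adj u v → (u ∈ A ↔ v ∉ A))
    (hconn : IsKEdgeConnected G 6) (k : V → ℕ)
    (hk : ∀ v, 5 * k v = #{e : CDE G A | e.1.1 = v}) (Y : Finset V) :
    Module.finrank (ZMod 2) (Submodule.span (ZMod 2) (Set.range (cdVec G A))) ≤
      Module.finrank (ZMod 2) (Submodule.span (ZMod 2) (cdVec G A '' {e | e.1.1 ∈ Y})) +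
        ∑ v ∈ Yᶜ, (k v + 1) := by
  let X : Finset V := {v | v ∈ A ∧ v ∉ Y}
  by_cases hX : X = ∅
  · refine le_add_right (Submodule.finrank_mono (Submodule.span_mono ?_))
    rintro _ ⟨e, rfl⟩
    refine ⟨e, ?_, rfl⟩
    by_contra h
    have : e.1.1 ∈ X := by simpa [X] using ⟨e.2.1, h⟩
    simp [hX] at this
  obtain ⟨x0, hx0⟩ := nonempty_iff_ne_empty.2 hX
  let GY : SimpleGraph V :=
    { Adj := fun u v => G.Adj u v ∧ u ∉ X ∧ v ∉ X
      symm := ⟨fun u v h => ⟨h.1.symm, h.2.2, h.2.1⟩⟩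
      loopless := ⟨fun u h => G.loopless.irrefl u h.1⟩ }
  let S := Submodule.span (ZMod 2) (cdVec G A '' {e | e.1.1 ∈ Y})
  let CC := GY.ConnectedComponent
  let S' := Submodule.span (ZMod 2) (Set.range (fun C : CC => (Pi.single C.out 1 : V → ZMod 2)))
  have hself : ∀ f : V → ZMod 2, f + f = 0 := fun f => funext fun i => CharTwo.add_self_eq_zero _
  have hadj : ∀ u v, GY.Adj u v → (Pi.single u 1 + Pi.single v 1 : V → ZMod 2) ∈ S := by
    have : ∀ u v, GY.Adj u v → u ∈ A → (Pi.single u 1 + Pi.single v 1 : V → ZMod 2) ∈ S := by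
      intro u v h hu
      refine Submodule.subset_span ⟨⟨(u, v), hu, h.1⟩, ?_, rfl⟩
      have := h.2.1
      simpa [X, hu] using this
    intro u v h
    by_cases hu : u ∈ A
    · exact this u v h hu
    · rw [add_comm]
      refine this v u h.symm ?_
      by_contra hv
      exact hu ((hbip _ _ h.1).2 hv)
  have hreach : ∀ u v, GY.Reachable u v → (Pi.single u 1 + Pi.single v 1 : V → ZMod 2) ∈ S := by
    rintro u v ⟨w⟩
    induction w with
    | nil => rw [hself]; exact S.zero_mem
    | @cons u v w h _ ih =>
      have := S.add_mem (hadj u v h) ih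
      rwa [add_assoc, ← add_assoc (Pi.single v 1), hself, zero_add] at this
  have htop : S ⊔ S' = ⊤ := by
    rw [eq_top_iff]
    intro f _
    have : f = ∑ v, f v • (Pi.single v 1 : V → ZMod 2) := by
      ext i
      simp [Finset.sum_apply, Pi.single_apply]
    rw [this]
    refine Submodule.sum_mem _ fun v _ => Submodule.smul_mem _ _ ?_
    have h1 : GY.Reachable v (GY.connectedComponentMk v).out :=
      SimpleGraph.ConnectedComponent.exact (Quot.out_eq _).symm
    have h2 := hreach _ _ h1
    have h3 : (Pi.single (GY.connectedComponentMk v).out 1 : V → ZMod 2) ∈ S' :=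
      Submodule.subset_span ⟨_, rfl⟩
    have := Submodule.add_mem_sup h2 h3
    rwa [add_assoc, hself, add_zero] at this
  have f1 : Fintype.card V ≤ Module.finrank (ZMod 2) S + Fintype.card CC := by
    calc Fintype.card V = Module.finrank (ZMod 2) (V → ZMod 2) := by simp
      _ = Module.finrank (ZMod 2) (⊤ : Submodule (ZMod 2) (V → ZMod 2)) := by simp
      _ = Module.finrank (ZMod 2) ↥(S ⊔ S') := by rw [htop]
      _ ≤ Module.finrank (ZMod 2) S + Module.finrank (ZMod 2) S' :=
          Submodule.finrank_add_le_finrank_add_finrank _ _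
      _ ≤ _ := by
          have := finrank_range_le_card (R := ZMod 2)
            (fun C : CC => (Pi.single C.out 1 : V → ZMod 2))
          exact Nat.add_le_add_left this _
  have f2 : Module.finrank (ZMod 2) (Submodule.span (ZMod 2) (Set.range (cdVec G A))) ≤
      Fintype.card V := by
    have := Submodule.finrank_le (Submodule.span (ZMod 2) (Set.range (cdVec G A)))
    simpa using this
  have f3 : Fintype.card CC ≤ #X + ∑ v ∈ X, k v := by
    let O : Finset CC := univ \ X.image GY.connectedComponentMk
    have g1 : Fintype.card CC ≤ #X + #O := by
      have h1 : #(X.image GY.connectedComponentMk) ≤ #X := card_image_le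
      have h2 : #O + #(X.image GY.connectedComponentMk) = Fintype.card CC :=
        card_sdiff_add_card_eq_card (subset_univ _)
      omega
    have g2 : ∀ C ∈ O, 6 ≤ #{e : CDE G A | e.1.1 ∈ X ∧ GY.connectedComponentMk e.1.2 = C} := by
      intro C hC
      have hC' : ∀ x ∈ X, GY.connectedComponentMk x ≠ C := by
        intro x hx h
        simp only [O, mem_sdiff, mem_image, not_exists, not_and] at hC
        exact hC.2 x hx h
      refine (cd_cut G A hbip hconn {v | GY.connectedComponentMk v = C} C.out x0
        (Quot.out_eq _) (hC' x0 hx0)).trans (card_le_card ?_)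
      intro e he
      simp only [mem_filter, mem_univ, true_and, Set.mem_ofPred_eq] at he ⊢
      have hy : e.1.2 ∉ X := by
        have := (hbip _ _ e.2.2).1 e.2.1
        simp [X, this]
      have hx : e.1.1 ∈ X := by
        by_contra hx
        apply he
        have : GY.Adj e.1.1 e.1.2 := ⟨e.2.2, hx, hy⟩
        rw [SimpleGraph.ConnectedComponent.sound this.reachable]
      refine ⟨hx, ?_⟩
      have := hC' _ hx
      tauto
    have g3 : #O * 6 ≤ #{e : CDE G A | e.1.1 ∈ X} := by
      calc #O * 6 ≤ ∑ C ∈ O, #{e : CDE G A | e.1.1 ∈ X ∧ GY.connectedComponentMk e.1.2 = C} := by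
            rw [← smul_eq_mul]; exact card_nsmul_le_sum _ _ _ g2
        _ = #(O.biUnion fun C => {e : CDE G A | e.1.1 ∈ X ∧ GY.connectedComponentMk e.1.2 = C}) := by
            rw [card_biUnion]
            intro a _ b _ hab
            refine disjoint_left.2 ?_
            intro e h1 h2
            simp only [mem_filter] at h1 h2
            exact hab (h1.2.2.symm.trans h2.2.2)
        _ ≤ _ := by
            apply card_le_card
            intro e he
            simp only [mem_biUnion, mem_filter, mem_univ, true_and] at he ⊢
            obtain ⟨_, _, h, _⟩ := he
            exact h
    have g4 : #{e : CDE G A | e.1.1 ∈ X} = ∑ v ∈ X, 5 * k v := by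
      rw [card_eq_sum_card_fiberwise (f := fun e : CDE G A => e.1.1) (t := X)]
      · refine sum_congr rfl fun v hv => ?_
        rw [hk, filter_filter]
        congr 1
        ext e
        simp only [mem_filter, mem_univ, true_and]
        constructor
        · exact fun h => h.2
        · exact fun h => ⟨h ▸ hv, h⟩
      · intro e he
        simpa using he
    rw [← mul_sum] at g4
    omega
  have f4 : ∑ v ∈ X, (k v + 1) ≤ ∑ v ∈ Yᶜ, (k v + 1) := by
    apply sum_le_sum_of_subset
    intro v hv
    simp only [X, mem_filter] at hv
    simpa using hv.2.2
  rw [sum_add_distrib, sum_const, smul_eq_mul, mul_one] at f4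
  change _ ≤ Module.finrank (ZMod 2) S + _
  omega

open Finset in
open Classical in
theorem cd_tree {V : Type} [Fintype V] (G : SimpleGraph V) (A : Set V)
    (hbip : ∀ u v, G.Adj u v → (u ∈ A ↔ v ∉ A))
    (hconn : IsKEdgeConnected G 6) (k : V → ℕ)
    (hk : ∀ v, 5 * k v = #{e : CDE G A | e.1.1 = v}) :
    ∃ T : Finset (CDE G A), (∀ v, #{e ∈ T | e.1.1 = v} ≤ k v + 1) ∧
      ∀ g : V → ZMod 2, (∀ e ∈ T, g e.1.1 = g e.1.2) → ∀ u v, g u = g v := by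
  obtain ⟨T, hT, hspan⟩ := cd_rado (K := ZMod 2) (fun e : CDE G A => e.1.1) (cdVec G A)
    (fun v => k v + 1) (cd_star G A hbip hconn k hk)
  refine ⟨T, hT, fun g hg => ?_⟩
  let Φ : (V → ZMod 2) →ₗ[ZMod 2] ZMod 2 := ∑ v, g v • LinearMap.proj v
  have hΦ : ∀ e : CDE G A, Φ (cdVec G A e) = g e.1.1 + g e.1.2 := by
    intro e
    simp [Φ, cdVec, LinearMap.sum_apply, Pi.single_apply, mul_add, sum_add_distrib]
  have h1 : Submodule.span (ZMod 2) (cdVec G A '' T) ≤ LinearMap.ker Φ := by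
    apply Submodule.span_le.2
    rintro _ ⟨e, he, rfl⟩
    simp only [SetLike.mem_coe, LinearMap.mem_ker]
    rw [hΦ, hg e he, CharTwo.add_self_eq_zero]
  rw [hspan] at h1
  have h2 : ∀ e : CDE G A, g e.1.1 = g e.1.2 := by
    intro e
    have := h1 (Submodule.subset_span ⟨e, rfl⟩)
    rw [LinearMap.mem_ker, hΦ] at this
    exact CharTwo.add_eq_zero.1 this
  have h3 : ∀ u v, G.Adj u v → g u = g v := by
    intro u v h
    by_cases hu : u ∈ A
    · exact h2 ⟨(u, v), hu, h⟩
    · refine (h2 ⟨(v, u), ?_, h.symm⟩).symm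
      by_contra hv
      exact hu ((hbip _ _ h).2 hv)
  intro u v
  have := (hconn ∅ (by simp)).preconnected u v
  simp only [coe_empty, SimpleGraph.deleteEdges_empty] at this
  obtain ⟨w⟩ := this
  induction w with
  | nil => rfl
  | cons h _ ih => exact (h3 _ _ h).trans ih

open Finset in
open Classical in
theorem cd_connected_pairs {V : Type} [Fintype V] (G : SimpleGraph V) (A : Set V)
    (hbip : ∀ u v, G.Adj u v → (u ∈ A ↔ v ∉ A))
    (k : V → ℕ)
    (hk : ∀ v, 5 * k v = #{e : CDE G A | e.1.1 = v})
    (T : Finset (CDE G A)) (hT : ∀ v, #{e ∈ T | e.1.1 = v} ≤ k v + 1)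
    (hcon : ∀ g : V → ZMod 2, (∀ e ∈ T, g e.1.1 = g e.1.2) → ∀ u v, g u = g v)
    (P : Finset V) : (∀ v ∈ P, v ∈ A) →
    ∃ p q : ∀ v, Fin (k v) → CDE G A,
      (∀ v ∈ P, Function.Injective (p v) ∧ Function.Injective (q v) ∧ (∀ i j, p v i ≠ q v j) ∧
        (∀ i, (p v i).1.1 = v ∧ (q v i).1.1 = v)) ∧
      ∀ g : V → ZMod 2, (∀ v ∈ P, ∀ i, g (p v i).1.2 = g (q v i).1.2) →
        (∀ e ∈ T, e.1.1 ∉ P → g e.1.1 = g e.1.2) → ∀ b ∉ A, ∀ b' ∉ A, g b = g b' := by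
  have hyA : ∀ e : CDE G A, e.1.2 ∉ A := fun e => (hbip _ _ e.2.2).1 e.2.1
  induction P using Finset.induction_on with
  | empty =>
    intro _
    have hne : ∀ v, Nonempty (Fin (k v) → CDE G A) := by
      intro v
      by_cases h : k v = 0
      · exact ⟨fun i => absurd i.2 (by omega)⟩
      · have : 0 < #{e : CDE G A | e.1.1 = v} := by rw [← hk]; omega
        obtain ⟨e, _⟩ := card_pos.1 this
        exact ⟨fun _ => e⟩
    refine ⟨fun v => (hne v).some, fun v => (hne v).some, by simp, ?_⟩
    intro g _ h b _ b' _
    exact hcon g (fun e he => h e he (by simp)) b b'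
  | insert v P hv ih =>
    intro hPA
    obtain ⟨p, q, hpq, hg⟩ := ih (fun u hu => hPA u (mem_insert_of_mem hu))
    have hvA : v ∈ A := hPA v (mem_insert_self _ _)
    have hyv : ∀ e : CDE G A, e.1.2 ≠ v := fun e h => hyA e (h ▸ hvA)
    let R : (V → ZMod 2) → Prop := fun g => (∀ u ∈ P, ∀ i, g (p u i).1.2 = g (q u i).1.2) ∧
      (∀ e ∈ T, e.1.1 ∉ insert v P → g e.1.1 = g e.1.2)
    let c : CDE G A → Set V := fun e => {w | ∀ g, R g → g e.1.2 = g w}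
    let N : Finset (CDE G A) := {e | e.1.1 = v}
    have hself : ∀ e, e.1.2 ∈ c e := fun e g _ => rfl
    have hceq : ∀ e s : CDE G A, s.1.2 ∈ c e → c e = c s := by
      intro e s hs
      ext w
      constructor
      · intro hw g hR
        rw [← hs g hR]; exact hw g hR
      · intro hw g hR
        rw [hs g hR]; exact hw g hR
    have hclaim : ∀ e, (∃ s ∈ T, s.1.1 = v ∧ c e = c s) ∨ ∀ b ∉ A, b ∈ c e := by
      intro e
      by_contra! hcon
      obtain ⟨h1, b, hb, hbc⟩ := hcon
      let ψ : V → ZMod 2 := fun w => if w ∈ c e ∧ w ≠ v then 1 else 0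
      have hψ := hg ψ ?_ ?_ e.1.2 (hyA e) b hb
      · simp [ψ, hself e, hyv e, hbc] at hψ
      · intro u hu i
        have : (p u i).1.2 ∈ c e ↔ (q u i).1.2 ∈ c e := by
          constructor
          · intro h g hR; rw [h g hR]; exact hR.1 u hu i
          · intro h g hR; rw [h g hR]; exact (hR.1 u hu i).symm
        simp only [ψ, this, hyv, ne_eq, not_false_eq_true, and_true]
      · intro s hs hsP
        by_cases hsv : s.1.1 = v
        · have : s.1.2 ∉ c e := fun h => h1 s hs hsv (hceq e s h)
          simp [ψ, hsv, this]
        · have hsP' : s.1.1 ∉ insert v P := by simp [hsv, hsP]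
          have : s.1.1 ∈ c e ↔ s.1.2 ∈ c e := by
            constructor
            · intro h g hR; rw [h g hR]; exact hR.2 s hs hsP'
            · intro h g hR; rw [h g hR]; exact (hR.2 s hs hsP').symm
          simp only [ψ, this, hyv, hsv, ne_eq, not_false_eq_true, and_true]
    have himg : #(N.image c) ≤ k v + 1 := by
      by_cases hh : ∃ e0, ∀ b ∉ A, b ∈ c e0
      · obtain ⟨e0, he0⟩ := hh
        have : N.image c ⊆ {c e0} := by
          intro a ha
          obtain ⟨e, he, rfl⟩ := mem_image.1 ha
          rw [mem_singleton]
          exact (hceq e0 e (he0 _ (hyA e))).symm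
        have := card_le_card this
        rw [card_singleton] at this
        omega
      · have : N.image c ⊆ ({e ∈ T | e.1.1 = v} : Finset _).image c := by
          intro a ha
          obtain ⟨e, he, rfl⟩ := mem_image.1 ha
          rcases hclaim e with ⟨s, hs, hsv, h⟩ | h
          · rw [h]; exact mem_image_of_mem _ (by simp [hs, hsv])
          · exact absurd ⟨e, h⟩ hh
        exact (card_le_card this).trans (card_image_le.trans (hT v))
    have hpairs : ∃ p q : Fin (k v) → CDE G A,
      Function.Injective p ∧ Function.Injective q ∧ (∀ i j, p i ≠ q j) ∧
      (∀ i, p i ∈ N ∧ q i ∈ N) ∧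
      ∀ g : CDE G A → ZMod 2, (∀ u ∈ N, ∀ w ∈ N, c u = c w → g u = g w) →
        (∀ i, g (p i) = g (q i)) → ∀ u ∈ N, ∀ w ∈ N, g u = g w := by
      by_cases h0 : k v = 0
      · have hN : N = ∅ := by
          rw [← card_eq_zero, ← hk, h0]
        have : IsEmpty (Fin (k v)) := by rw [h0]; infer_instance
        refine ⟨isEmptyElim, isEmptyElim, fun i => isEmptyElim i, fun i => isEmptyElim i,
          fun i => isEmptyElim i, fun i => isEmptyElim i, ?_⟩
        intro g _ _ u hu
        simp [hN] at hu
      · refine cd_pairs (k v) N c himg ?_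
        have : 5 * k v = #N := hk v
        omega
    obtain ⟨p0, q0, pinj, qinj, hne, hN, hconst⟩ := hpairs
    refine ⟨Function.update p v p0, Function.update q v q0, ?_, ?_⟩
    · intro u hu
      by_cases huv : u = v
      · subst huv
        simp only [Function.update_self]
        exact ⟨pinj, qinj, hne, fun i => by simpa [N] using hN i⟩
      · simp only [Function.update_of_ne huv]
        exact hpq u ((mem_insert.1 hu).resolve_left huv)
    · intro g h1 h2
      have hR : R g := by
        refine ⟨fun u hu i => ?_, h2⟩
        have huv : u ≠ v := by rintro rfl; exact hv hu
        have := h1 u (mem_insert_of_mem hu)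
        simp only [Function.update_of_ne huv] at this
        exact this i
      have hcN : ∀ u ∈ N, ∀ w ∈ N, g u.1.2 = g w.1.2 := by
        apply hconst (fun e => g e.1.2)
        · intro u _ w _ huw
          have := hself w
          rw [← huw] at this
          exact this g hR
        · have := h1 v (mem_insert_self _ _)
          simpa only [Function.update_self] using this
      let a : ZMod 2 := if h : ∃ s ∈ T, s.1.1 = v then g h.choose.1.2 else 0
      intro b hb b' hb'
      have hbv : b ≠ v := by rintro rfl; exact hb hvA
      have hbv' : b' ≠ v := by rintro rfl; exact hb' hvA
      have := hg (Function.update g v a) ?_ ?_ b hb b' hb'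
      · simpa only [Function.update_of_ne hbv, Function.update_of_ne hbv'] using this
      · intro u hu i
        simp only [Function.update_of_ne (hyv _)]
        exact hR.1 u hu i
      · intro s hs hsP
        simp only [Function.update_of_ne (hyv _)]
        by_cases hsv : s.1.1 = v
        · have hex : ∃ s ∈ T, s.1.1 = v := ⟨s, hs, hsv⟩
          rw [hsv, Function.update_self]
          simp only [a, dif_pos hex]
          exact hcN _ (by simpa [N] using hex.choose_spec.2) _ (by simpa [N] using hsv)
        · rw [Function.update_of_ne hsv]
          exact h2 s hs (by simp [hsv, hsP])

open Finset in
open Classical in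
theorem cd_exists_M {V : Type} [Fintype V] (G : SimpleGraph V) (A : Set V)
    (hbip : ∀ u v, G.Adj u v → (u ∈ A ↔ v ∉ A))
    (hconn : IsKEdgeConnected G 6) (k : V → ℕ)
    (hk : ∀ v, 5 * k v = #{e : CDE G A | e.1.1 = v}) :
    ∃ M : Finset (CDE G A), (∀ v, #{e ∈ M | e.1.1 = v} = k v) ∧
      ∀ b, Even #{e ∈ univ \ M | e.1.2 = b} := by
  obtain ⟨T, hT, hcon⟩ := cd_tree G A hbip hconn k hk
  obtain ⟨p, q, hpq, hg⟩ := cd_connected_pairs G A hbip k hk T hT hcon ({v | v ∈ A} : Finset V)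
    (by simp)
  have hyA : ∀ e : CDE G A, e.1.2 ∉ A := fun e => (hbip _ _ e.2.2).1 e.2.1
  have hvA : ∀ v, Fin (k v) → v ∈ A := by
    intro v i
    have : 0 < #{e : CDE G A | e.1.1 = v} := by rw [← hk]; have := i.2; omega
    obtain ⟨e, he⟩ := card_pos.1 this
    simp only [mem_filter] at he
    exact he.2 ▸ e.2.1
  have hpq : ∀ v, Function.Injective (p v) ∧ Function.Injective (q v) ∧ (∀ i j, p v i ≠ q v j) ∧
        (∀ i, (p v i).1.1 = v ∧ (q v i).1.1 = v) := by
    intro v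
    by_cases hv : v ∈ A
    · exact hpq v (by simpa using hv)
    · exact ⟨fun i => absurd (hvA v i) hv, fun i => absurd (hvA v i) hv,
        fun i => absurd (hvA v i) hv, fun i => absurd (hvA v i) hv⟩
  let J := Σ v, Fin (k v)
  let P : J → CDE G A := fun j => p j.1 j.2
  let Q : J → CDE G A := fun j => q j.1 j.2
  let sg : V → (V → ZMod 2) := fun v => Pi.single v 1
  let u : J → (V → ZMod 2) := fun j => sg (P j).1.2 + sg (Q j).1.2
  let τ : V → ZMod 2 := ∑ e : CDE G A, sg e.1.2 + ∑ j, sg (P j).1.2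
  have hτ : τ ∈ Submodule.span (ZMod 2) (Set.range u) := by
    by_contra hτ
    obtain ⟨f, hf, hker⟩ := Submodule.exists_le_ker_of_notMem hτ
    apply hf
    have hu : ∀ j, f (sg (P j).1.2) = f (sg (Q j).1.2) := by
      intro j
      have := hker (Submodule.subset_span ⟨j, rfl⟩)
      rw [LinearMap.mem_ker, map_add] at this
      exact CharTwo.add_eq_zero.1 this
    have hB := hg (fun v => f (sg v)) (fun v _ i => hu ⟨v, i⟩)
      (fun e _ h => absurd (by simpa using e.2.1) h)
    by_cases hE : Nonempty (CDE G A)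
    · obtain ⟨e0⟩ := hE
      have h1 : ∀ e : CDE G A, f (sg e.1.2) = f (sg e0.1.2) :=
        fun e => hB _ (hyA e) _ (hyA e0)
      have h2 : Fintype.card (CDE G A) = 5 * ∑ v, k v := by
        rw [mul_sum, ← card_univ, card_eq_sum_card_fiberwise (f := fun e : CDE G A => e.1.1)
          (t := univ) (by simp)]
        exact sum_congr rfl fun v _ => (hk v).symm
      have h3 : Fintype.card J = ∑ v, k v := by simp [J]
      simp only [τ, map_add, map_sum, h1, sum_const, card_univ, h2, h3, ← add_smul]
      have : 5 * ∑ v, k v + ∑ v, k v = 2 * (3 * ∑ v, k v) := by ring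
      rw [this, mul_smul, two_smul, CharTwo.add_self_eq_zero]
    · have hE : IsEmpty (CDE G A) := not_nonempty_iff.1 hE
      have hJ : IsEmpty J := ⟨fun j => hE.elim (P j)⟩
      simp [τ]
  obtain ⟨ε, hε⟩ := (Submodule.mem_span_range_iff_exists_fun _).1 hτ
  let sel : J → CDE G A := fun j => if ε j = 0 then P j else Q j
  have hselx : ∀ j, (sel j).1.1 = j.1 := by
    intro j
    simp only [sel]
    split_ifs
    · exact ((hpq j.1).2.2.2 j.2).1
    · exact ((hpq j.1).2.2.2 j.2).2
  have hseli : ∀ v (i i' : Fin (k v)), sel ⟨v, i⟩ = sel ⟨v, i'⟩ → i = i' := by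
    intro v i i' h
    simp only [sel] at h
    split_ifs at h
    · exact (hpq v).1 h
    · exact absurd h ((hpq v).2.2.1 _ _)
    · exact absurd h.symm ((hpq v).2.2.1 _ _)
    · exact (hpq v).2.1 h
  have hinj : Function.Injective sel := by
    rintro ⟨v, i⟩ ⟨v', i'⟩ h
    have h1 := hselx ⟨v, i⟩
    rw [h, hselx] at h1
    simp only at h1
    subst h1
    rw [hseli _ _ _ h]
  have hsely : ∀ j, sg (sel j).1.2 = sg (P j).1.2 + ε j • u j := by
    intro j
    have h01 : ∀ z : ZMod 2, z ≠ 0 → z = 1 := by decide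
    simp only [sel, u]
    split_ifs with h
    · rw [h, zero_smul, add_zero]
    · rw [h01 _ h, one_smul, ← add_assoc]
      have : sg (P j).1.2 + sg (P j).1.2 = 0 := funext fun i => CharTwo.add_self_eq_zero _
      rw [this, zero_add]
  refine ⟨univ.image sel, ?_, ?_⟩
  · intro v
    have : ({e ∈ univ.image sel | e.1.1 = v} : Finset _) =
        (univ : Finset (Fin (k v))).image (fun i => sel ⟨v, i⟩) := by
      ext e
      simp only [mem_filter, mem_image, mem_univ, true_and]
      constructor
      · rintro ⟨⟨⟨v', i⟩, rfl⟩, h⟩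
        rw [hselx] at h
        simp only at h
        subst h
        exact ⟨i, rfl⟩
      · rintro ⟨i, rfl⟩
        exact ⟨⟨_, rfl⟩, hselx _⟩
    rw [this, card_image_of_injective _ (fun i i' h => hseli v i i' h)]
    simp
  · intro b
    have hsum : ∑ j, sg (sel j).1.2 = ∑ e : CDE G A, sg e.1.2 := by
      simp only [hsely, sum_add_distrib, hε]
      simp only [τ]
      rw [add_comm, add_assoc]
      have : ∑ j, sg (P j).1.2 + ∑ j, sg (P j).1.2 = 0 :=
        funext fun i => CharTwo.add_self_eq_zero _
      rw [this, add_zero]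
    have hcnt : ∀ S : Finset (CDE G A), (∑ e ∈ S, sg e.1.2) b = (#{e ∈ S | e.1.2 = b} : ZMod 2) := by
      intro S
      rw [Finset.sum_apply, card_filter, Nat.cast_sum]
      refine sum_congr rfl fun e _ => ?_
      simp only [sg, Pi.single_apply]
      by_cases h : e.1.2 = b
      · simp [h]
      · simp [h, Ne.symm h]
    have h1 := hcnt (univ.image sel)
    rw [sum_image (fun _ _ _ _ h => hinj h), hsum, hcnt] at h1
    have h2 : #{e ∈ univ \ univ.image sel | e.1.2 = b} + #{e ∈ univ.image sel | e.1.2 = b} =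
        #{e : CDE G A | e.1.2 = b} := by
      rw [← card_union_of_disjoint, ← filter_union, sdiff_union_of_subset (subset_univ _)]
      exact disjoint_filter_filter sdiff_disjoint
    rw [← h2, Nat.cast_add, add_eq_right] at h1
    exact (ZMod.natCast_eq_zero_iff_even).1 h1

open Finset in
open Classical in
theorem cd_color {E V : Type} [Fintype E] [Fintype V] (x y : E → V) (k : V → ℕ)
    (hk : ∀ v, 5 * k v = #{e | x e = v}) (M : Finset E)
    (hM : ∀ v, #{e ∈ M | x e = v} = k v) (hpar : ∀ b, Even #{e ∈ univ \ M | y e = b}) :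
    ∃ col : E → Fin 5, (∀ v i, #{e ∈ ({e | col e = i} : Finset E) | x e = v} = k v) ∧
      ∀ b, #{e ∈ ({e | col e = 1} : Finset E) | y e = b} =
          #{e ∈ ({e | col e = 2} : Finset E) | y e = b} ∧
        #{e ∈ ({e | col e = 3} : Finset E) | y e = b} =
          #{e ∈ ({e | col e = 4} : Finset E) | y e = b} := by
  have hsplit : ∀ (s t : Finset E) (q : E → Prop), t ⊆ s → #{e ∈ s \ t | q e} + #{e ∈ t | q e} =
      #{e ∈ s | q e} := by
    intro s t q hts
    rw [← card_union_of_disjoint, ← filter_union, sdiff_union_of_subset hts]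
    exact disjoint_filter_filter sdiff_disjoint
  have hs : ∀ v, #{e ∈ univ \ M | x e = v} = 4 * k v := by
    intro v
    have := hsplit univ M (fun e => x e = v) (subset_univ _)
    rw [hM, ← hk] at this
    omega
  obtain ⟨t, hts, htx, hty⟩ := cd_halve (univ \ M) x y
    (fun v => by rw [hs]; exact ⟨2 * k v, by ring⟩) hpar
  obtain ⟨φ, hφ⟩ := cd_fiber_equiv t ((univ \ M) \ t) y y (by
    intro b
    have := hsplit _ t (fun e => y e = b) hts
    have := hty b
    omega)
  have c1 : ∀ v, #{e : t | x e = v} = 2 * k v := by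
    intro v
    have h1 : #{e : t | x e = v} = #{e ∈ t | x e = v} := by
      refine card_bij (fun e _ => e.1) ?_ ?_ ?_
      · intro e he; simpa using he
      · intro e _ e' _ h; exact Subtype.ext h
      · intro e he
        simp only [mem_filter] at he
        exact ⟨⟨e, he.1⟩, by simpa using he.2, rfl⟩
    have := htx v
    rw [hs] at this
    omega
  have c2 : ∀ v, #{e : t | x (φ e) = v} = 2 * k v := by
    intro v
    have h1 : #{e : t | x (φ e) = v} = #{e ∈ (univ \ M) \ t | x e = v} := by
      refine card_bij (fun e _ => (φ e).1) ?_ ?_ ?_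
      · intro e he
        have := (φ e).2
        simp only [mem_filter, mem_univ, true_and] at he
        exact mem_filter.2 ⟨this, he⟩
      · intro e _ e' _ h; exact φ.injective (Subtype.ext h)
      · intro e he
        obtain ⟨he1, he2⟩ := mem_filter.1 he
        exact ⟨φ.symm ⟨e, he1⟩, by simpa using he2, by simp⟩
    have h2 := htx v
    have h3 := hsplit _ t (fun e => x e = v) hts
    rw [hs] at h2 h3
    omega
  obtain ⟨t1, -, h1x, h1y⟩ := cd_halve (univ : Finset t) (fun e => x e) (fun e => x (φ e))
    (fun v => by rw [c1]; exact even_two_mul _) (fun v => by rw [c2]; exact even_two_mul _)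
  have htM : ∀ e : t, e.1 ∉ M := fun e => (mem_sdiff.1 (hts e.2)).2
  have hφM : ∀ e : t, (φ e).1 ∉ M := fun e => (mem_sdiff.1 (mem_sdiff.1 (φ e).2).1).2
  have hφt : ∀ e : t, (φ e).1 ∉ t := fun e => (mem_sdiff.1 (φ e).2).2
  let col : E → Fin 5 := fun e =>
    if hM : e ∈ M then 0 else
    if ht : e ∈ t then (if (⟨e, ht⟩ : t) ∈ t1 then 1 else 3) else
      (if φ.symm ⟨e, mem_sdiff.2 ⟨mem_sdiff.2 ⟨mem_univ _, hM⟩, ht⟩⟩ ∈ t1 then 2 else 4)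
  have k0 : ∀ e ∈ M, col e = 0 := fun e he => by simp [col, he]
  have k1 : ∀ e : t, col e = if e ∈ t1 then 1 else 3 := fun e => by
    simp [col, htM e]
  have k2 : ∀ e : t, col (φ e) = if e ∈ t1 then 2 else 4 := fun e => by
    simp [col, hφM e, hφt e]
  have k3 : ∀ e, e ∈ M ∨ (∃ e' : t, e = e') ∨ ∃ e' : t, e = φ e' := by
    intro e
    by_cases h1 : e ∈ M
    · exact Or.inl h1
    by_cases h2 : e ∈ t
    · exact Or.inr (Or.inl ⟨⟨e, h2⟩, rfl⟩)
    · refine Or.inr (Or.inr ⟨φ.symm ⟨e, mem_sdiff.2 ⟨mem_sdiff.2 ⟨mem_univ _, h1⟩, h2⟩⟩, by simp⟩)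
  have n0 : ∀ q : E → Prop, #{e ∈ ({e | col e = 0} : Finset E) | q e} = #{e ∈ M | q e} := by
    intro q
    congr 2
    ext e
    simp only [mem_filter, mem_univ, true_and]
    refine ⟨fun h => ?_, k0 e⟩
    rcases k3 e with h' | ⟨e', rfl⟩ | ⟨e', rfl⟩
    · exact h'
    · rw [k1] at h; split_ifs at h <;> exact absurd h (by decide)
    · rw [k2] at h; split_ifs at h <;> exact absurd h (by decide)
  have n1 : ∀ q : E → Prop, #{e ∈ ({e | col e = 1} : Finset E) | q e} =
      #(t1.filter (fun e : t => q e.1)) := by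
    intro q
    symm
    refine card_bij (fun e _ => e.1) ?_ (fun e _ e' _ h => Subtype.ext h) ?_
    · intro e he
      simp only [mem_filter, mem_univ, true_and] at he ⊢
      rw [k1, if_pos he.1]; exact ⟨rfl, he.2⟩
    · intro e he
      simp only [mem_filter, mem_univ, true_and] at he
      rcases k3 e with h' | ⟨e', rfl⟩ | ⟨e', rfl⟩
      · rw [k0 e h'] at he; exact absurd he.1 (by decide)
      · rw [k1] at he
        split_ifs at he with h
        · exact ⟨e', mem_filter.2 ⟨h, he.2⟩, rfl⟩
        · exact absurd he.1 (by decide)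
      · rw [k2] at he; split_ifs at he <;> exact absurd he.1 (by decide)
  have n2 : ∀ q : E → Prop, #{e ∈ ({e | col e = 2} : Finset E) | q e} = #{e ∈ t1 | q (φ e)} := by
    intro q
    symm
    refine card_bij (fun e _ => (φ e).1) ?_ (fun e _ e' _ h => φ.injective (Subtype.ext h)) ?_
    · intro e he
      simp only [mem_filter, mem_univ, true_and] at he ⊢
      rw [k2, if_pos he.1]; exact ⟨rfl, he.2⟩
    · intro e he
      simp only [mem_filter, mem_univ, true_and] at he
      rcases k3 e with h' | ⟨e', rfl⟩ | ⟨e', rfl⟩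
      · rw [k0 e h'] at he; exact absurd he.1 (by decide)
      · rw [k1] at he; split_ifs at he <;> exact absurd he.1 (by decide)
      · rw [k2] at he
        split_ifs at he with h
        · exact ⟨e', mem_filter.2 ⟨h, he.2⟩, rfl⟩
        · exact absurd he.1 (by decide)
  have n3 : ∀ q : E → Prop, #{e ∈ ({e | col e = 3} : Finset E) | q e} =
      #((univ \ t1).filter (fun e : t => q e.1)) := by
    intro q
    symm
    refine card_bij (fun e _ => e.1) ?_ (fun e _ e' _ h => Subtype.ext h) ?_
    · intro e he
      simp only [mem_filter, mem_univ, true_and, mem_sdiff] at he ⊢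
      rw [k1, if_neg he.1]; exact ⟨rfl, he.2⟩
    · intro e he
      simp only [mem_filter, mem_univ, true_and] at he
      rcases k3 e with h' | ⟨e', rfl⟩ | ⟨e', rfl⟩
      · rw [k0 e h'] at he; exact absurd he.1 (by decide)
      · rw [k1] at he
        split_ifs at he with h
        · exact absurd he.1 (by decide)
        · exact ⟨e', mem_filter.2 ⟨by simpa using h, he.2⟩, rfl⟩
      · rw [k2] at he; split_ifs at he <;> exact absurd he.1 (by decide)
  have n4 : ∀ q : E → Prop, #{e ∈ ({e | col e = 4} : Finset E) | q e} =
      #{e ∈ univ \ t1 | q (φ e)} := by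
    intro q
    symm
    refine card_bij (fun e _ => (φ e).1) ?_ (fun e _ e' _ h => φ.injective (Subtype.ext h)) ?_
    · intro e he
      simp only [mem_filter, mem_univ, true_and, mem_sdiff] at he ⊢
      rw [k2, if_neg he.1]; exact ⟨rfl, he.2⟩
    · intro e he
      simp only [mem_filter, mem_univ, true_and] at he
      rcases k3 e with h' | ⟨e', rfl⟩ | ⟨e', rfl⟩
      · rw [k0 e h'] at he; exact absurd he.1 (by decide)
      · rw [k1] at he; split_ifs at he <;> exact absurd he.1 (by decide)
      · rw [k2] at he
        split_ifs at he with h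
        · exact absurd he.1 (by decide)
        · exact ⟨e', mem_filter.2 ⟨by simpa using h, he.2⟩, rfl⟩
  have hsplit' : ∀ (q : t → Prop), #{e ∈ univ \ t1 | q e} + #{e ∈ t1 | q e} =
      #{e : t | q e} := by
    intro q
    rw [← card_union_of_disjoint, ← filter_union, sdiff_union_of_subset (subset_univ _)]
    exact disjoint_filter_filter sdiff_disjoint
  refine ⟨col, ?_, ?_⟩
  · intro v i
    have a1 := h1x v
    have a2 := h1y v
    have a3 := hsplit' (fun e => x e = v)
    have a4 := hsplit' (fun e => x (φ e) = v)
    rw [c1] at a1 a3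
    rw [c2] at a2 a4
    fin_cases i
    · exact (n0 _).trans (hM v)
    · refine (n1 _).trans ?_; omega
    · refine (n2 _).trans ?_; omega
    · refine (n3 _).trans ?_; omega
    · refine (n4 _).trans ?_; omega
  · intro b
    constructor
    · rw [n1, n2]; simp only [hφ]
    · rw [n3, n4]; simp only [hφ]

open Finset in
open Classical in
theorem cd_mu {P Q V : Type} [Fintype P] [Fintype Q] [Fintype V] (l r : P → V) (h tl : Q → V)
    (hinj : ∀ q q', h q = h q' → tl q = tl q' → q = q')
    (hl : ∀ p, 2 ≤ #{p' | l p' = l p}) (hr : ∀ p, 2 ≤ #{p' | r p' = r p})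
    (μ0 : P ≃ Q) (hμ0 : ∀ p, h (μ0 p) = l p) :
    ∃ μ : P ≃ Q, (∀ p, h (μ p) = l p) ∧ ∀ p, ∃ p', r p' = r p ∧ tl (μ p') ≠ tl (μ p) := by
  obtain ⟨t, -, htl, htr⟩ := cd_exists_half (univ : Finset P) l r
  have hred : ∀ p, ∃ p' ∈ t, l p' = l p := by
    intro p
    have h1 := htl (l p)
    have h2 := hl p
    have : 0 < #{e ∈ t | l e = l p} := by omega
    obtain ⟨p', hp'⟩ := card_pos.1 this
    exact ⟨p', (mem_filter.1 hp').1, (mem_filter.1 hp').2⟩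
  have hblue : ∀ p, ∃ p' ∉ t, r p' = r p := by
    intro p
    have h1 := htr (r p)
    have h2 := hr p
    have : 0 < #{e ∈ univ \ t | r e = r p} := by omega
    obtain ⟨p', hp'⟩ := card_pos.1 this
    simp only [mem_filter, mem_sdiff, mem_univ, true_and] at hp'
    exact ⟨p', hp'.1, hp'.2⟩
  let bad : (P ≃ Q) → Finset V := fun μ =>
    {d | (∃ p, r p = d) ∧ ∀ p p', r p = d → r p' = d → tl (μ p) = tl (μ p')}
  let valid : Finset (P ≃ Q) := {μ | ∀ p, h (μ p) = l p}
  obtain ⟨μ1, hμ1, hmin⟩ := exists_min_image valid (fun μ => #(bad μ))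
    ⟨μ0, by simpa [valid] using hμ0⟩
  by_cases hb : bad μ1 = ∅
  · refine ⟨μ1, by simpa [valid] using hμ1, fun p => ?_⟩
    by_contra! hcon
    have : r p ∈ bad μ1 := by
      simp only [bad, mem_filter, mem_univ, true_and]
      refine ⟨⟨p, rfl⟩, fun p1 p2 h1 h2 => ?_⟩
      rw [hcon p1 h1, hcon p2 h2]
    simp [hb] at this
  exfalso
  obtain ⟨d0, hd0⟩ := nonempty_iff_ne_empty.2 hb
  obtain ⟨p0, hp0⟩ : ∃ p, r p = d0 := by
    simp only [bad, mem_filter, mem_univ, true_and] at hd0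
    exact hd0.1
  let a := tl (μ1 p0)
  let Sa : Finset (P ≃ Q) := {μ | μ ∈ valid ∧ #(bad μ) ≤ #(bad μ1) ∧
    ∃ p, r p ∈ bad μ ∧ tl (μ p) = a}
  obtain ⟨μ, hμ, hmax⟩ := exists_max_image Sa (fun μ => #{p ∈ t | tl (μ p) = a})
    ⟨μ1, by
      simp only [Sa, mem_filter, mem_univ, true_and]
      exact ⟨hμ1, le_rfl, p0, hp0 ▸ hd0, rfl⟩⟩
  simp only [Sa, mem_filter, mem_univ, true_and] at hμ hmax
  obtain ⟨hval, hcard, p1, hp1, hp1a⟩ := hμ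
  have hval' : ∀ p, h (μ p) = l p := by simpa [valid] using hval
  have hbadd : ∀ p, r p = r p1 → tl (μ p) = a := by
    intro p hp
    have := hp1
    simp only [bad, mem_filter, mem_univ, true_and] at this
    rw [← hp1a]
    exact this.2 p p1 hp rfl
  obtain ⟨p, hpt, hpr⟩ := hblue p1
  obtain ⟨p', hpt', hpl'⟩ := hred p
  have hpa := hbadd p hpr
  have hpp : p ≠ p' := by rintro rfl; exact hpt hpt'
  have hpa' : tl (μ p') ≠ a := by
    intro hh
    apply hpp
    apply μ.injective
    exact hinj _ _ (by rw [hval', hval', hpl']) (by rw [hpa, hh])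
  have hpr' : r p' ≠ r p1 := fun hh => hpa' (hbadd p' hh)
  let μ' : P ≃ Q := (Equiv.swap p p').trans μ
  have m1 : μ' p = μ p' := by simp [μ']
  have m2 : μ' p' = μ p := by simp [μ']
  have m3 : ∀ z, z ≠ p → z ≠ p' → μ' z = μ z := fun z h1 h2 => by
    simp [μ', Equiv.swap_apply_of_ne_of_ne h1 h2]
  have hval2 : μ' ∈ valid := by
    simp only [valid, mem_filter, mem_univ, true_and]
    intro z
    by_cases h1 : z = p
    · rw [h1, m1, hval', hpl']
    by_cases h2 : z = p'
    · rw [h2, m2, hval', hpl']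
    rw [m3 z h1 h2, hval']
  have hgood : r p1 ∉ bad μ' := by
    intro hh
    simp only [bad, mem_filter, mem_univ, true_and] at hh
    obtain ⟨p2, hp2, hne⟩ := exists_mem_ne (lt_of_lt_of_le one_lt_two (hr p1)) p
    simp only [mem_filter, mem_univ, true_and] at hp2
    have := hh.2 p p2 hpr hp2
    rw [m1, m3 p2 hne (by rintro rfl; exact hpr' hp2), hbadd p2 hp2] at this
    exact hpa' this
  have hsub : ∀ d ∈ bad μ', d ≠ r p' → d ∈ (bad μ).erase (r p1) := by
    intro d hd hne
    have hne1 : d ≠ r p1 := by rintro rfl; exact hgood hd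
    refine mem_erase.2 ⟨hne1, ?_⟩
    simp only [bad, mem_filter, mem_univ, true_and] at hd ⊢
    refine ⟨hd.1, fun z z' hz hz' => ?_⟩
    have := hd.2 z z' hz hz'
    rw [m3 z (by rintro rfl; exact hne1 (hz.symm.trans hpr)) (by rintro rfl; exact hne hz.symm),
      m3 z' (by rintro rfl; exact hne1 (hz'.symm.trans hpr)) (by rintro rfl; exact hne hz'.symm)]
      at this
    exact this
  have herase : #((bad μ).erase (r p1)) = #(bad μ) - 1 := card_erase_of_mem hp1
  have hpos : 0 < #(bad μ) := card_pos.2 ⟨_, hp1⟩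
  by_cases hbp : r p' ∈ bad μ'
  · have h1 : bad μ' ⊆ insert (r p') ((bad μ).erase (r p1)) := by
      intro d hd
      by_cases hdp : d = r p'
      · exact mem_insert.2 (Or.inl hdp)
      · exact mem_insert_of_mem (hsub d hd hdp)
    have h2 := card_le_card h1
    have h3 := card_insert_le (r p') ((bad μ).erase (r p1))
    have h4 := hmax μ' ⟨hval2, by omega, p', hbp, by rw [m2, hpa]⟩
    have h5 : insert p' ({p ∈ t | tl (μ p) = a} : Finset P) ⊆
        ({p ∈ t | tl (μ' p) = a} : Finset P) := by
      intro z hz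
      rcases mem_insert.1 hz with rfl | hz
      · exact mem_filter.2 ⟨hpt', by rw [m2, hpa]⟩
      · obtain ⟨hz1, hz2⟩ := mem_filter.1 hz
        refine mem_filter.2 ⟨hz1, ?_⟩
        rw [m3 z (by rintro rfl; exact hpt hz1) (by rintro rfl; exact hpa' hz2)]
        exact hz2
    have h6 := card_le_card h5
    rw [card_insert_of_notMem (by simp [hpa'])] at h6
    omega
  · have h1 : bad μ' ⊆ (bad μ).erase (r p1) := fun d hd =>
      hsub d hd (by rintro rfl; exact hbp hd)
    have h2 := card_le_card h1
    have h3 := hmin μ' hval2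
    omega

open Finset in
open Classical in
theorem cd_avoid {P Q V : Type} [Fintype P] [Fintype Q] (lab : P → V) (mid : Q → V)
    (hcard : Fintype.card P = Fintype.card Q) (hmid : Function.Injective mid)
    (hlab : ∀ p, ∃ p', lab p' ≠ lab p) : ∃ e : P ≃ Q, ∀ p, lab p ≠ mid (e p) := by
  let T : P → Finset Q := fun p => {q | lab p ≠ mid q}
  have key : ∀ Z, #Z ≤ #(Z.biUnion T) := by
    intro Z
    rcases Z.eq_empty_or_nonempty with rfl | ⟨p, hp⟩
    · simp
    by_cases hZ : Z = univ
    · have : Z.biUnion T = univ := by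
        rw [eq_univ_iff_forall]
        intro q
        obtain ⟨p', hp'⟩ := hlab p
        simp only [mem_biUnion, T, mem_filter, mem_univ, true_and, hZ]
        by_cases h : lab p = mid q
        · exact ⟨p', by rw [← h]; exact hp'⟩
        · exact ⟨p, h⟩
      rw [this, hZ, card_univ, card_univ, hcard]
    · have h1 : #Z < Fintype.card P := (card_lt_iff_ne_univ Z).2 hZ
      have h2 : #(T p) ≤ #(Z.biUnion T) := card_le_card (subset_biUnion_of_mem T hp)
      have h3 : #({q | lab p = mid q} : Finset Q) ≤ 1 := by
        rw [card_le_one]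
        intro q hq q' hq'
        simp only [mem_filter, mem_univ, true_and] at hq hq'
        exact hmid (hq.symm.trans hq')
      have h4 : #({q | lab p = mid q} : Finset Q) + #(T p) = Fintype.card Q := by
        rw [← card_univ]; exact card_filter_add_card_filter_not _
      omega
  obtain ⟨f, finj, hf⟩ := (Finset.all_card_le_biUnion_card_iff_exists_injective T).1 key
  refine ⟨Equiv.ofBijective f ((Fintype.bijective_iff_injective_and_card f).2 ⟨finj, hcard⟩), ?_⟩
  intro p
  simpa [T] using hf p

open Finset in
open Classical in
theorem cd_decomp {E V : Type} [Fintype E] [Fintype V] (x y : E → V) (k : V → ℕ)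
    (hxy : ∀ e e', x e = x e' → y e = y e' → e = e')
    (hk2 : ∀ e, 2 ≤ k (x e)) (E0 E1 E2 E3 E4 : Finset E)
    (h0 : ∀ v, #{e ∈ E0 | x e = v} = k v) (h1 : ∀ v, #{e ∈ E1 | x e = v} = k v)
    (h2 : ∀ v, #{e ∈ E2 | x e = v} = k v) (h3 : ∀ v, #{e ∈ E3 | x e = v} = k v)
    (h12 : ∀ b, #{e ∈ E1 | y e = b} = #{e ∈ E2 | y e = b})
    (h34 : ∀ b, #{e ∈ E3 | y e = b} = #{e ∈ E4 | y e = b}) :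
    ∃ (μ : E1 ≃ E0) (φ : E1 ≃ E2) (ν : E1 ≃ E3) (ψ : E3 ≃ E4),
      (∀ e, x (μ e) = x e) ∧ (∀ e, y (φ e) = y e) ∧ (∀ e, x (ν e) = x (φ e)) ∧
      (∀ e, y (ψ e) = y e) ∧ ∀ e, y (μ e) ≠ y (ν e) := by
  obtain ⟨φ, hφ⟩ := cd_fiber_equiv E1 E2 y y h12
  obtain ⟨ψ, hψ⟩ := cd_fiber_equiv E3 E4 y y h34
  obtain ⟨μ0, hμ0⟩ := cd_fiber_equiv E1 E0 x x (fun v => by rw [h0, h1])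
  have cnt : ∀ (u : Finset E) (v : V), #{e : u | x e = v} = #{e ∈ u | x e = v} := by
    intro u v
    refine card_bij (fun e _ => e.1) ?_ ?_ ?_
    · intro e he; simpa using he
    · intro e _ e' _ h; exact Subtype.ext h
    · intro e he
      simp only [mem_filter] at he
      exact ⟨⟨e, he.1⟩, by simpa using he.2, rfl⟩
  have cnt2 : ∀ v, #{e : E1 | x (φ e) = v} = k v := by
    intro v
    rw [← h2, ← cnt]
    refine card_bij (fun e _ => φ e) ?_ ?_ ?_
    · intro e he; simpa using he
    · intro e _ e' _ h; exact φ.injective h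
    · intro e he
      exact ⟨φ.symm e, by simpa using he, by simp⟩
  obtain ⟨μ, hμ, hbad⟩ := cd_mu (fun e : E1 => x e) (fun e : E1 => x (φ e))
    (fun e : E0 => x e) (fun e : E0 => y e)
    (fun q q' h h' => Subtype.ext (hxy _ _ h h'))
    (fun p => by rw [cnt, h1]; exact hk2 _)
    (fun p => by rw [cnt2]; exact hk2 _) μ0 hμ0
  have hν : ∀ d, ∃ e : {p : E1 // x (φ p) = d} ≃ {q : E3 // x q = d},
      ∀ p, y (μ p.1) ≠ y (e p).1 := by
    intro d
    refine cd_avoid (fun p : {p : E1 // x (φ p) = d} => y (μ p.1))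
      (fun q : {q : E3 // x q = d} => y q.1) ?_ ?_ ?_
    · rw [Fintype.card_subtype, Fintype.card_subtype, cnt2, cnt, h3]
    · intro q q' h
      exact Subtype.ext (Subtype.ext (hxy _ _ (q.2.trans q'.2.symm) h))
    · rintro ⟨p, hp⟩
      obtain ⟨p', h, h'⟩ := hbad p
      exact ⟨⟨p', h.trans hp⟩, h'⟩
  choose F hF using hν
  let ν : E1 ≃ E3 := Equiv.ofFiberEquiv (f := fun e : E1 => x (φ e)) (g := fun e : E3 => x e) F
  refine ⟨μ, φ, ν, ψ, hμ, hφ, ?_, hψ, ?_⟩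
  · intro e
    exact Equiv.ofFiberEquiv_map (f := fun e : E1 => x (φ e)) (g := fun e : E3 => x e) F e
  · intro e
    exact hF _ ⟨e, rfl⟩

/-- The edge `e` with the direction prescribed by its colour. -/
def cdDir {V : Type} {G : SimpleGraph V} {A : Set V} (col : CDE G A → Fin 5) (e : CDE G A) :
    V × V :=
  if col e = 1 ∨ col e = 3 then (e.1.1, e.1.2) else (e.1.2, e.1.1)

theorem cd_notMem {V : Type} {G : SimpleGraph V} {A : Set V}
    (hbip : ∀ u v, G.Adj u v → (u ∈ A ↔ v ∉ A)) (e : CDE G A) : e.1.2 ∉ A :=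
  (hbip _ _ e.2.2).1 e.2.1

theorem cd_mem_image {V : Type} {G : SimpleGraph V} {A : Set V}
    (hbip : ∀ u v, G.Adj u v → (u ∈ A ↔ v ∉ A)) (col : CDE G A → Fin 5) (P : CDE G A → Prop)
    (u v : V) : (u, v) ∈ cdDir col '' {e | P e} ↔
      (u ∈ A ∧ v ∉ A ∧ ∃ e, P e ∧ (col e = 1 ∨ col e = 3) ∧ e.1.1 = u ∧ e.1.2 = v) ∨
      (u ∉ A ∧ v ∈ A ∧ ∃ e, P e ∧ ¬ (col e = 1 ∨ col e = 3) ∧ e.1.1 = v ∧ e.1.2 = u) := by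
  constructor
  · rintro ⟨e, he, h⟩
    have h1 := e.2.1
    have h2 := cd_notMem hbip e
    unfold cdDir at h
    split_ifs at h with hc
    · obtain ⟨rfl, rfl⟩ := Prod.mk.inj h
      exact Or.inl ⟨h1, h2, e, he, hc, rfl, rfl⟩
    · obtain ⟨rfl, rfl⟩ := Prod.mk.inj h
      exact Or.inr ⟨h2, h1, e, he, hc, rfl, rfl⟩
  · rintro (⟨-, -, e, he, hc, rfl, rfl⟩ | ⟨-, -, e, he, hc, rfl, rfl⟩)
    · exact ⟨e, he, by simp [cdDir, hc]⟩
    · exact ⟨e, he, by simp only [cdDir, if_neg hc]⟩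

theorem cd_dir_inj {V : Type} {G : SimpleGraph V} {A : Set V}
    (hbip : ∀ u v, G.Adj u v → (u ∈ A ↔ v ∉ A)) (col : CDE G A → Fin 5) :
    Function.Injective (cdDir col) := by
  intro e e' h
  have h1 := e.2.1
  have h2 := cd_notMem hbip e
  have h1' := e'.2.1
  have h2' := cd_notMem hbip e'
  unfold cdDir at h
  apply Subtype.ext
  apply Prod.ext
  · split_ifs at h <;> simp only [Prod.mk.injEq] at h
    · exact h.1
    · rw [h.1] at h1; exact absurd h1 h2'
    · rw [← h.1] at h1'; exact absurd h1' h2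
    · exact h.2
  · split_ifs at h <;> simp only [Prod.mk.injEq] at h
    · exact h.2
    · rw [h.1] at h1; exact absurd h1 h2'
    · rw [← h.1] at h1'; exact absurd h1' h2
    · exact h.1

open Finset in
open Classical in
theorem cd_deg {V : Type} [Fintype V] {G : SimpleGraph V} {A : Set V}
    (hbip : ∀ u v, G.Adj u v → (u ∈ A ↔ v ∉ A)) (col : CDE G A → Fin 5) (P : CDE G A → Prop)
    (v : V) :
    (v ∈ A → {u | (u, v) ∈ cdDir col '' {e | P e}}.ncard =
        #{e | (P e ∧ ¬ (col e = 1 ∨ col e = 3)) ∧ e.1.1 = v} ∧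
      {u | (v, u) ∈ cdDir col '' {e | P e}}.ncard =
        #{e | (P e ∧ (col e = 1 ∨ col e = 3)) ∧ e.1.1 = v}) ∧
    (v ∉ A → {u | (u, v) ∈ cdDir col '' {e | P e}}.ncard =
        #{e | (P e ∧ (col e = 1 ∨ col e = 3)) ∧ e.1.2 = v} ∧
      {u | (v, u) ∈ cdDir col '' {e | P e}}.ncard =
        #{e | (P e ∧ ¬ (col e = 1 ∨ col e = 3)) ∧ e.1.2 = v}) := by
  have i1 : ∀ (Q : CDE G A → Prop) {inst : DecidablePred (fun e : CDE G A => Q e ∧ e.1.1 = v)},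
      #(@Finset.filter _ (fun e : CDE G A => Q e ∧ e.1.1 = v) inst univ) =
      {u | ∃ e : CDE G A, Q e ∧ e.1.1 = v ∧ e.1.2 = u}.ncard := by
    intro Q inst
    rw [← card_image_of_injOn (f := fun e : CDE G A => e.1.2), ← Set.ncard_coe_finset]
    · congr 1; ext u; simp [and_assoc]
    · intro e he e' he' h
      simp only [coe_filter, mem_univ, true_and, Set.mem_ofPred_eq] at he he'
      exact Subtype.ext (Prod.ext (he.2.trans he'.2.symm) h)
  have i2 : ∀ (Q : CDE G A → Prop) {inst : DecidablePred (fun e : CDE G A => Q e ∧ e.1.2 = v)},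
      #(@Finset.filter _ (fun e : CDE G A => Q e ∧ e.1.2 = v) inst univ) =
      {u | ∃ e : CDE G A, Q e ∧ e.1.1 = u ∧ e.1.2 = v}.ncard := by
    intro Q inst
    rw [← card_image_of_injOn (f := fun e : CDE G A => e.1.1), ← Set.ncard_coe_finset]
    · congr 1; ext u
      simp only [coe_image, coe_filter, mem_univ, true_and, Set.mem_image, Set.mem_ofPred_eq]
      exact exists_congr fun e => by tauto
    · intro e he e' he' h
      simp only [coe_filter, mem_univ, true_and, Set.mem_ofPred_eq] at he he'
      exact Subtype.ext (Prod.ext h (he.2.trans he'.2.symm))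
  refine ⟨fun hv => ⟨?_, ?_⟩, fun hv => ⟨?_, ?_⟩⟩
  · rw [i1]; congr 1; ext u
    rw [Set.mem_ofPred_eq, cd_mem_image hbip]
    constructor
    · rintro (⟨-, h, -⟩ | ⟨-, -, e, h⟩)
      · exact absurd hv h
      · exact ⟨e, ⟨h.1, h.2.1⟩, h.2.2⟩
    · rintro ⟨e, h, rfl, rfl⟩
      exact Or.inr ⟨cd_notMem hbip e, hv, e, h.1, h.2, rfl, rfl⟩
  · rw [i1]; congr 1; ext u
    rw [Set.mem_ofPred_eq, cd_mem_image hbip]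
    constructor
    · rintro (⟨-, -, e, h⟩ | ⟨h, -⟩)
      · exact ⟨e, ⟨h.1, h.2.1⟩, h.2.2⟩
      · exact absurd hv h
    · rintro ⟨e, h, rfl, rfl⟩
      exact Or.inl ⟨hv, cd_notMem hbip e, e, h.1, h.2, rfl, rfl⟩
  · rw [i2]; congr 1; ext u
    rw [Set.mem_ofPred_eq, cd_mem_image hbip]
    constructor
    · rintro (⟨-, -, e, h⟩ | ⟨-, h, -⟩)
      · exact ⟨e, ⟨h.1, h.2.1⟩, h.2.2⟩
      · exact absurd h hv
    · rintro ⟨e, h, rfl, rfl⟩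
      exact Or.inl ⟨e.2.1, hv, e, h.1, h.2, rfl, rfl⟩
  · rw [i2]; congr 1; ext u
    rw [Set.mem_ofPred_eq, cd_mem_image hbip]
    constructor
    · rintro (⟨h, -⟩ | ⟨-, -, e, h⟩)
      · exact absurd h hv
      · exact ⟨e, ⟨h.1, h.2.1⟩, h.2.2⟩
    · rintro ⟨e, h, rfl, rfl⟩
      exact Or.inr ⟨hv, e.2.1, e, h.1, h.2, rfl, rfl⟩

theorem cd_orient {V : Type} (G : SimpleGraph V) (A : Set V)
    (hbip : ∀ u v, G.Adj u v → (u ∈ A ↔ v ∉ A)) (col : CDE G A → Fin 5) :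
    IsOrientationOf (fun u v => (u, v) ∈ cdDir col '' {_e | True}) G := by
  constructor
  · intro u v
    simp only [cd_mem_image hbip]
    constructor
    · intro h
      have hb := hbip _ _ h
      by_cases hu : u ∈ A
      · by_cases hc : col ⟨(u, v), hu, h⟩ = 1 ∨ col ⟨(u, v), hu, h⟩ = 3
        · exact Or.inl (Or.inl ⟨hu, hb.1 hu, _, trivial, hc, rfl, rfl⟩)
        · exact Or.inr (Or.inr ⟨hb.1 hu, hu, _, trivial, hc, rfl, rfl⟩)
      · have hv : v ∈ A := by tauto
        by_cases hc : col ⟨(v, u), hv, h.symm⟩ = 1 ∨ col ⟨(v, u), hv, h.symm⟩ = 3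
        · exact Or.inr (Or.inl ⟨hv, hu, _, trivial, hc, rfl, rfl⟩)
        · exact Or.inl (Or.inr ⟨hu, hv, _, trivial, hc, rfl, rfl⟩)
    · rintro ((⟨-, -, e, -, -, rfl, rfl⟩ | ⟨-, -, e, -, -, rfl, rfl⟩) |
        (⟨-, -, e, -, -, rfl, rfl⟩ | ⟨-, -, e, -, -, rfl, rfl⟩))
      · exact e.2.2
      · exact e.2.2.symm
      · exact e.2.2.symm
      · exact e.2.2
  · rintro u v ⟨h1, h2⟩
    rw [cd_mem_image hbip] at h1 h2
    have key : ∀ e e' : CDE G A, e.1.1 = e'.1.1 → e.1.2 = e'.1.2 → e = e' :=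
      fun e e' h h' => Subtype.ext (Prod.ext h h')
    rcases h1 with ⟨a1, a2, e, -, c, x1, y1⟩ | ⟨a1, a2, e, -, c, x1, y1⟩ <;>
    rcases h2 with ⟨b1, b2, e', -, c', x2, y2⟩ | ⟨b1, b2, e', -, c', x2, y2⟩
    · exact absurd b1 a2
    · rw [key e e' (x1.trans x2.symm) (y1.trans y2.symm)] at c; exact c' c
    · rw [key e e' (x1.trans x2.symm) (y1.trans y2.symm)] at c; exact c c'
    · exact absurd a2 b1

open Finset in
open Classical in
theorem cd_frac {V : Type} [Fintype V] (G : SimpleGraph V) (A : Set V)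
    (hbip : ∀ u v, G.Adj u v → (u ∈ A ↔ v ∉ A)) (k : V → ℕ)
    (hk : ∀ v, 5 * k v = #{e : CDE G A | e.1.1 = v}) (col : CDE G A → Fin 5)
    (hx : ∀ v i, #{e ∈ ({e | col e = i} : Finset (CDE G A)) | e.1.1 = v} = k v)
    (hy : ∀ b, #{e ∈ ({e | col e = 1} : Finset (CDE G A)) | e.1.2 = b} =
          #{e ∈ ({e | col e = 2} : Finset (CDE G A)) | e.1.2 = b} ∧
        #{e ∈ ({e | col e = 3} : Finset (CDE G A)) | e.1.2 = b} =
          #{e ∈ ({e | col e = 4} : Finset (CDE G A)) | e.1.2 = b}) :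
    IsFracFactorization (fun u v => (u, v) ∈ cdDir col '' {_e | True}) A
      (cdDir col '' {e | col e = 0}) (cdDir col '' {e | col e = 1 ∨ col e = 2})
      (cdDir col '' {e | col e = 3 ∨ col e = 4}) := by
  have hinj := cd_dir_inj hbip col
  have aux : ∀ (P Q : CDE G A → Prop) (i : Fin 5), (∀ e, (P e ∧ Q e) ↔ col e = i) →
      ∀ (z : CDE G A → V) (v : V)
        {inst : DecidablePred (fun e : CDE G A => (P e ∧ Q e) ∧ z e = v)},
      #(@Finset.filter _ (fun e : CDE G A => (P e ∧ Q e) ∧ z e = v) inst univ) =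
        #{e ∈ ({e | col e = i} : Finset (CDE G A)) | z e = v} := by
    intro P Q i h z v inst
    congr 1; ext e
    simp [h]
  refine ⟨?_, ?_, ?_, ?_, ?_, ?_, ?_⟩
  · rw [← Set.image_union, ← Set.image_union]
    change _ = cdDir col '' {_e | True}
    congr 1
    ext e
    simp only [Set.mem_union, Set.mem_ofPred_eq, iff_true]
    generalize col e = c
    revert c; decide
  · refine (Set.disjoint_image_iff hinj).2 (Set.disjoint_left.2 fun e => ?_)
    simp only [Set.mem_ofPred_eq]
    generalize col e = c
    revert c; decide
  · refine (Set.disjoint_image_iff hinj).2 (Set.disjoint_left.2 fun e => ?_)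
    simp only [Set.mem_ofPred_eq]
    generalize col e = c
    revert c; decide
  · refine (Set.disjoint_image_iff hinj).2 (Set.disjoint_left.2 fun e => ?_)
    simp only [Set.mem_ofPred_eq]
    generalize col e = c
    revert c; decide
  · rintro ⟨u, v⟩ h
    rw [cd_mem_image hbip] at h
    rcases h with ⟨-, -, e, h0, h1, -⟩ | ⟨h1, h2, -⟩
    · rw [h0] at h1; exact absurd h1 (by decide)
    · exact ⟨h1, h2⟩
  · intro v hv
    have hD : dDeg (fun u v => (u, v) ∈ cdDir col '' {_e | True}) v = 5 * k v := by
      have h := (cd_deg hbip col (fun _ => True) v).1 hv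
      unfold dDeg
      rw [h.1, h.2, hk]
      rw [← card_filter_add_card_filter_not (s := ({e | e.1.1 = v} : Finset (CDE G A)))
        (fun e => ¬ (col e = 1 ∨ col e = 3)), filter_filter, filter_filter]
      congr 2
      · ext e; simp only [mem_filter, mem_univ, true_and]; tauto
      · ext e; simp only [mem_filter, mem_univ, true_and]; tauto
    rw [hD, Nat.mul_div_cancel_left _ (by norm_num : 0 < 5)]
    have hM := (cd_deg hbip col (fun e => col e = 0) v).1 hv
    have hF := (cd_deg hbip col (fun e => col e = 1 ∨ col e = 2) v).1 hv
    have hH := (cd_deg hbip col (fun e => col e = 3 ∨ col e = 4) v).1 hv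
    refine ⟨hF.1.trans ?_, hF.2.trans ?_, hH.1.trans ?_, hH.2.trans ?_, hM.1.trans ?_⟩
    · refine (aux _ _ 2 (fun e => ?_) _ v).trans (hx v 2)
      generalize col e = c; revert c; decide
    · refine (aux _ _ 1 (fun e => ?_) _ v).trans (hx v 1)
      generalize col e = c; revert c; decide
    · refine (aux _ _ 4 (fun e => ?_) _ v).trans (hx v 4)
      generalize col e = c; revert c; decide
    · refine (aux _ _ 3 (fun e => ?_) _ v).trans (hx v 3)
      generalize col e = c; revert c; decide
    · refine (aux _ _ 0 (fun e => ?_) _ v).trans (hx v 0)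
      generalize col e = c; revert c; decide
  · intro v hv
    have hF := (cd_deg hbip col (fun e => col e = 1 ∨ col e = 2) v).2 hv
    have hH := (cd_deg hbip col (fun e => col e = 3 ∨ col e = 4) v).2 hv
    refine ⟨(hF.1.trans ?_).trans hF.2.symm, (hH.1.trans ?_).trans hH.2.symm⟩
    · refine ((aux _ _ 1 (fun e => ?_) _ v).trans (hy v).1).trans
        (aux _ _ 2 (fun e => ?_) _ v).symm
      · generalize col e = c; revert c; decide
      · generalize col e = c; revert c; decide
    · refine ((aux _ _ 3 (fun e => ?_) _ v).trans (hy v).2).trans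
        (aux _ _ 4 (fun e => ?_) _ v).symm
      · generalize col e = c; revert c; decide
      · generalize col e = c; revert c; decide

open Finset in
open Classical in
theorem cd_canon {V : Type} [Fintype V] (G : SimpleGraph V) (A : Set V)
    (hbip : ∀ u v, G.Adj u v → (u ∈ A ↔ v ∉ A)) (col : CDE G A → Fin 5)
    (μ : ({e | col e = 1} : Finset (CDE G A)) ≃ ({e | col e = 0} : Finset (CDE G A)))
    (φ : ({e | col e = 1} : Finset (CDE G A)) ≃ ({e | col e = 2} : Finset (CDE G A)))
    (ν : ({e | col e = 1} : Finset (CDE G A)) ≃ ({e | col e = 3} : Finset (CDE G A)))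
    (ψ : ({e | col e = 3} : Finset (CDE G A)) ≃ ({e | col e = 4} : Finset (CDE G A)))
    (h1 : ∀ e, (μ e).1.1.1 = e.1.1.1) (h2 : ∀ e, (φ e).1.1.2 = e.1.1.2)
    (h3 : ∀ e, (ν e).1.1.1 = (φ e).1.1.1) (h4 : ∀ e, (ψ e).1.1.2 = e.1.1.2)
    (h5 : ∀ e, (μ e).1.1.2 ≠ (ν e).1.1.2) :
    HasCanonicalDecomposition (fun u v => (u, v) ∈ cdDir col '' {_e | True})
      (cdDir col '' {e | col e = 0}) (cdDir col '' {e | col e = 1 ∨ col e = 2})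
      (cdDir col '' {e | col e = 3 ∨ col e = 4}) := by
  have hinj := cd_dir_inj hbip col
  have cμ : ∀ p, col (μ p).1 = 0 := fun p => (mem_filter.1 (μ p).2).2
  have cp : ∀ p : ({e | col e = 1} : Finset (CDE G A)), col p.1 = 1 :=
    fun p => (mem_filter.1 p.2).2
  have cφ : ∀ p, col (φ p).1 = 2 := fun p => (mem_filter.1 (φ p).2).2
  have cν : ∀ p, col (ν p).1 = 3 := fun p => (mem_filter.1 (ν p).2).2
  have cψ : ∀ p, col (ψ p).1 = 4 := fun p => (mem_filter.1 (ψ p).2).2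
  let t : ({e | col e = 1} : Finset (CDE G A)) → V × V × V × V × V × V := fun p =>
    ((μ p).1.1.2, p.1.1.1, p.1.1.2, (φ p).1.1.1, (ν p).1.1.2, (ψ (ν p)).1.1.1)
  have d0 : ∀ p, ((μ p).1.1.2, p.1.1.1) = cdDir col (μ p).1 := by
    intro p; simp [cdDir, cμ, h1]
  have d1 : ∀ p : ({e | col e = 1} : Finset (CDE G A)),
      (p.1.1.1, p.1.1.2) = cdDir col p.1 := by
    intro p; simp [cdDir, cp]
  have d2 : ∀ p, (p.1.1.2, (φ p).1.1.1) = cdDir col (φ p).1 := by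
    intro p; simp [cdDir, cφ, h2]
  have d3 : ∀ p, ((φ p).1.1.1, (ν p).1.1.2) = cdDir col (ν p).1 := by
    intro p; simp [cdDir, cν, h3]
  have d4 : ∀ p, ((ν p).1.1.2, (ψ (ν p)).1.1.1) = cdDir col (ψ (ν p)).1 := by
    intro p; simp [cdDir, cψ, h4]
  have ht : ∀ p, tupleEdges5 (t p) =
      [(μ p).1, p.1, (φ p).1, (ν p).1, (ψ (ν p)).1].map (cdDir col) := by
    intro p
    simp only [tupleEdges5, t, List.map_cons, List.map_nil, ← d0, ← d1, ← d2, ← d3, ← d4]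
  have hmem : ∀ (p) (z : V × V), z ∈ tupleEdges5 (t p) ↔ ∃ e : CDE G A, cdDir col e = z ∧
      (e = (μ p).1 ∨ e = p.1 ∨ e = (φ p).1 ∨ e = (ν p).1 ∨ e = (ψ (ν p)).1) := by
    intro p z
    rw [ht, List.mem_map]
    simp only [List.mem_cons, List.not_mem_nil, or_false]
    exact exists_congr fun e => and_comm
  have hne : ∀ e e' : CDE G A, col e ≠ col e' → e.1.1 = e'.1.1 → e.1.2 ≠ e'.1.2 := by
    intro e e' hc h h'
    exact hc (congrArg col (Subtype.ext (Prod.ext h h')))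
  have hAB : ∀ e e' : CDE G A, e.1.1 ≠ e'.1.2 := by
    intro e e' h
    exact cd_notMem hbip e' (h ▸ e.2.1)
  let q := Fintype.equivFin ({e | col e = 1} : Finset (CDE G A))
  refine ⟨_, fun i => t (q.symm i), fun i => ?_, fun i => ?_, ?_, ?_⟩
  · change IsCanonicalElt _ _ _ (t (q.symm i))
    generalize q.symm i = p
    refine ⟨⟨(μ p).1, cμ p, (d0 p).symm⟩, ⟨p.1, Or.inl (cp p), (d1 p).symm⟩,
      ⟨(φ p).1, Or.inr (cφ p), (d2 p).symm⟩, ⟨(ν p).1, Or.inl (cν p), (d3 p).symm⟩,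
      ⟨(ψ (ν p)).1, Or.inr (cψ _), (d4 p).symm⟩, ?_⟩
    have e1 : (μ p).1.1.2 ≠ p.1.1.2 := hne _ _ (by rw [cμ, cp]; decide) (h1 p)
    have e2 : p.1.1.1 ≠ (φ p).1.1.1 := fun h =>
      hne p.1 (φ p).1 (by rw [cφ, cp]; decide) h (h2 p).symm
    have e3 : p.1.1.2 ≠ (ν p).1.1.2 := by
      rw [← h2]
      exact hne _ _ (by rw [cφ, cν]; decide) (h3 p).symm
    simp only [List.nodup_cons, List.mem_cons, List.not_mem_nil, or_false, not_or,
      not_false_eq_true, List.nodup_nil, and_true]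
    exact ⟨⟨(hAB _ _).symm, e1, (hAB _ _).symm, h5 p⟩, ⟨hAB _ _, e2, hAB _ _⟩,
      ⟨(hAB _ _).symm, e3⟩, hAB _ _⟩
  · generalize q.symm i = p
    simp only [ht]
    refine List.Nodup.map hinj (List.Nodup.of_map col ?_)
    simp only [List.map_cons, List.map_nil, cμ, cp, cφ, cν, cψ]
    decide
  · intro z
    simp only [hmem]
    constructor
    · rintro ⟨e, -, h⟩
      have : ∃ p, e = (μ p).1 ∨ e = p.1 ∨ e = (φ p).1 ∨ e = (ν p).1 ∨ e = (ψ (ν p)).1 := by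
        have hc : col e = 0 ∨ col e = 1 ∨ col e = 2 ∨ col e = 3 ∨ col e = 4 := by
          generalize col e = c
          revert c; decide
        rcases hc with hc | hc | hc | hc | hc
        · exact ⟨μ.symm ⟨e, by simp [hc]⟩, Or.inl (by simp)⟩
        · exact ⟨⟨e, by simp [hc]⟩, Or.inr (Or.inl rfl)⟩
        · exact ⟨φ.symm ⟨e, by simp [hc]⟩, Or.inr (Or.inr (Or.inl (by simp)))⟩
        · exact ⟨ν.symm ⟨e, by simp [hc]⟩, Or.inr (Or.inr (Or.inr (Or.inl (by simp))))⟩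
        · exact ⟨ν.symm (ψ.symm ⟨e, by simp [hc]⟩),
            Or.inr (Or.inr (Or.inr (Or.inr (by simp))))⟩
      obtain ⟨p, hp⟩ := this
      exact ⟨q p, e, h, by simpa using hp⟩
    · rintro ⟨i, e, h, -⟩
      exact ⟨e, trivial, h⟩
  · intro i j z hi hj
    rw [hmem] at hi hj
    obtain ⟨e, he, hi⟩ := hi
    obtain ⟨e', he', hj⟩ := hj
    obtain rfl : e = e' := hinj (he.trans he'.symm)
    apply q.symm.injective
    generalize q.symm i = a at *
    generalize q.symm j = b at *
    rcases hi with rfl | rfl | rfl | rfl | rfl <;>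
    rcases hj with h | h | h | h | h <;>
    first
    | exact μ.injective (Subtype.ext h)
    | exact Subtype.ext h
    | exact φ.injective (Subtype.ext h)
    | exact ν.injective (Subtype.ext h)
    | exact ν.injective (ψ.injective (Subtype.ext h))
    | (exfalso
       have hc := congrArg col h
       simp only [cμ, cp, cφ, cν, cψ] at hc
       exact absurd hc (by decide))

/-- Every `6`-edge-connected bipartite finite simple graph `G` with vertex classes
`A` and `Aᶜ` in which every vertex of `A` has degree divisible by `5` has an
orientation `D` admitting a fractional factorization `𝔉 = (M, F, H)` for `A`
together with an `𝔉`-canonical decomposition. -/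
theorem exists_orientation_with_canonical_decomposition
    {V : Type} [Fintype V] (G : SimpleGraph V) (A : Set V)
    (hbip : ∀ u v, G.Adj u v → (u ∈ A ↔ v ∉ A))
    (hconn : IsKEdgeConnected G 6)
    (hdeg : ∀ v ∈ A, 5 ∣ (G.neighborSet v).ncard) :
    ∃ (D : V → V → Prop) (M F H : Set (V × V)),
      IsOrientationOf D G ∧ IsFracFactorization D A M F H ∧
      HasCanonicalDecomposition D M F H := by
  classical
  have hdvd : ∀ v, 5 ∣ (Finset.univ.filter (fun e : CDE G A => e.1.1 = v)).card := by
    intro v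
    by_cases hv : v ∈ A
    · convert hdeg v hv using 1
      rw [← Finset.card_image_of_injOn (f := fun e : CDE G A => e.1.2), ← Set.ncard_coe_finset]
      · congr 1
        ext u
        simp only [Finset.coe_image, Finset.coe_filter, Finset.mem_univ, true_and, Set.mem_image,
          Set.mem_ofPred_eq, SimpleGraph.mem_neighborSet]
        constructor
        · rintro ⟨e, rfl, rfl⟩
          exact e.2.2
        · intro h
          exact ⟨⟨(v, u), hv, h⟩, rfl, rfl⟩
      · intro e he e' he' h
        simp only [Finset.coe_filter, Finset.mem_univ, true_and, Set.mem_ofPred_eq] at he he'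
        exact Subtype.ext (Prod.ext (he.trans he'.symm) h)
    · rw [Finset.filter_eq_empty_iff.2]
      · simp
      · intro e _ h
        exact hv (h ▸ e.2.1)
  choose k hk' using hdvd
  have hk : ∀ v, 5 * k v = (Finset.univ.filter (fun e : CDE G A => e.1.1 = v)).card :=
    fun v => (hk' v).symm
  have hk2 : ∀ e : CDE G A, 2 ≤ k e.1.1 := by
    intro e
    have h := cd_cut G A hbip hconn {e.1.1} e.1.1 e.1.2 rfl (fun h => e.2.2.ne h.symm)
    have h2 : 6 ≤ (Finset.univ.filter (fun e' : CDE G A => e'.1.1 = e.1.1)).card := by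
      refine le_trans (le_of_le_of_eq h ?_) (Finset.card_le_card (s := Finset.univ.filter
        (fun e' : CDE G A => ¬ (e'.1.1 ∈ ({e.1.1} : Set V) ↔ e'.1.2 ∈ ({e.1.1} : Set V)))) ?_)
      · congr!
      · intro e' he'
        simp only [Finset.mem_filter, Finset.mem_univ, true_and, Set.mem_singleton_iff] at he' ⊢
        by_contra hne
        have : e'.1.2 = e.1.1 := by tauto
        exact cd_notMem hbip e' (this ▸ e.2.1)
    have := hk e.1.1
    omega
  have hk3 : ∀ v, 5 * k v = (@Finset.filter _ (fun e : CDE G A => e.1.1 = v)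
      (fun _ => Classical.propDecidable _) Finset.univ).card := by
    intro v; rw [hk]
  obtain ⟨M, hM, hpar⟩ := cd_exists_M G A hbip hconn k (by convert hk3)
  obtain ⟨col, hx, hy⟩ := cd_color (fun e : CDE G A => e.1.1) (fun e : CDE G A => e.1.2) k
    (by convert hk3) M (by convert hM) (by convert hpar)
  obtain ⟨μ, φ, ν, ψ, h1, h2, h3, h4, h5⟩ := cd_decomp (fun e : CDE G A => e.1.1)
    (fun e : CDE G A => e.1.2) k (fun e e' h h' => Subtype.ext (Prod.ext h h')) hk2
    _ _ _ _ _ (fun v => hx v 0) (fun v => hx v 1) (fun v => hx v 2) (fun v => hx v 3)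
    (fun v => (hy v).1) (fun v => (hy v).2)
  exact ⟨_, _, _, _, cd_orient G A hbip col, cd_frac G A hbip k (by convert hk3) col
    (by convert hx) (by convert hy), cd_canon G A hbip col μ φ ν ψ h1 h2 h3 h4 h5⟩
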